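/- Let K be a flag simplicial complex on [m], and let n_k(K) := dim_{Z/2} (N_K)_k denote the dimensions of the graded components of N_K (which are finite). Then for every N ≥ 1 the following congruence holds in the polynomial ring Z[x] modulo x^{N+1}: ∏_{k=2}^{N} (1 − x^k)^{n_k(K)} ≡ Σ_{J ⊆ [m]} (Σ_{I ∈ K, I ⊆ J} (−1)^{|I|}) · x^{|J|} (mod x^{N+1}). Equivalently, ∏_{k ≥ 2} (1 − x^k)^{n_k(K)} = Σ_{J ⊆ [m]} (1 − χ(K_J)) x^{|J|} as formal power series, where 1 − χ(K_J) = Σ_{I ∈ K_J} (−1)^{|I|}. -/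

import Mathlib

/-- `K` is a simplicial complex on the vertex set `Fin m`. -/
def IsSimplicialComplex {m : ℕ} (K : Finset (Finset (Fin m))) : Prop :=
  (∀ I ∈ K, ∀ I' ⊆ I, I' ∈ K) ∧ ∅ ∈ K ∧ ∀ i : Fin m, ({i} : Finset (Fin m)) ∈ K

/-- `K` is flag: every set of vertices pairwise joined by `2`-element simplices
of `K` is itself a simplex of `K`. -/
def IsFlag {m : ℕ} (K : Finset (Finset (Fin m))) : Prop :=
  ∀ S : Finset (Fin m),
    (∀ i ∈ S, ∀ j ∈ S, i ≠ j → ({i, j} : Finset (Fin m)) ∈ K) → S ∈ K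

/-- `a` and `b` lie in the same connected component of the graph of the full
subcomplex `K_J`. -/
def connKJ {m : ℕ} (K : Finset (Finset (Fin m))) (J : Finset (Fin m)) :
    Fin m → Fin m → Prop :=
  Relation.ReflTransGen
    (fun a b => a ∈ J ∧ b ∈ J ∧ a ≠ b ∧ ({a, b} : Finset (Fin m)) ∈ K)

/-- `Θ_K(J)`: the set of vertices `j ∈ J` that are smallest in their connected
component of the graph of `K_J`, this component not containing `max J`. -/
def Theta {m : ℕ} (K : Finset (Finset (Fin m))) (J : Finset (Fin m)) (j : Fin m) : Prop :=
  ∃ hj : j ∈ J, (∀ i ∈ J, connKJ K J j i → j ≤ i) ∧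
    ¬ connKJ K J j (J.max' ⟨j, hj⟩)

/-- The Lie ideal of relations defining the graph Lie algebra `L_K` over `ℤ/2`. -/
noncomputable def LKrels {m : ℕ} (K : Finset (Finset (Fin m))) :
    LieIdeal (ZMod 2) (FreeLieAlgebra (ZMod 2) (Fin m)) :=
  LieSubmodule.lieSpan (ZMod 2) (FreeLieAlgebra (ZMod 2) (Fin m))
    {z | ∃ i j : Fin m, ({i, j} : Finset (Fin m)) ∈ K ∧
      z = ⁅FreeLieAlgebra.of (ZMod 2) i, FreeLieAlgebra.of (ZMod 2) j⁆}

/-- The graph Lie algebra `L_K` over `ℤ/2`. -/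
abbrev LK {m : ℕ} (K : Finset (Finset (Fin m))) :=
  FreeLieAlgebra (ZMod 2) (Fin m) ⧸ LKrels K

/-- The generators `μ₁, …, μ_m` of `L_K`. -/
noncomputable def mu {m : ℕ} (K : Finset (Finset (Fin m))) (i : Fin m) : LK K :=
  LieSubmodule.Quotient.mk (N := LKrels K) (FreeLieAlgebra.of (ZMod 2) i)

/-- For `q : Fin m → L` and `I = {t₁ < … < t_s} ⊆ [m]`, the nested commutator
`c_q(I, x) = ⁅q t₁, ⁅q t₂, … ⁅q t_s, x⁆…⁆⁆`, with `c_q(∅, x) = x`. -/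
def cNest {L : Type*} [LieRing L] {m : ℕ} (q : Fin m → L) (I : Finset (Fin m)) (x : L) : L :=
  (I.sort (· ≤ ·)).foldr (fun t acc => ⁅q t, acc⁆) x

/-- The set of GPTW generators of `L_K`. -/
def GPTWset {m : ℕ} (K : Finset (Finset (Fin m))) : Set (LK K) :=
  {z | ∃ (J : Finset (Fin m)) (j : Fin m),
    Theta K J j ∧ z = cNest (mu K) (J.erase j) (mu K j)}

/-- `N_K`, the Lie subalgebra of `L_K` generated by the GPTW generators. -/
noncomputable def NK {m : ℕ} (K : Finset (Finset (Fin m))) : LieSubalgebra (ZMod 2) (LK K) :=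
  LieSubalgebra.lieSpan (ZMod 2) (LK K) (GPTWset K)

/-- `IsBracketing k x` : `x` is an iterated bracket of `k` generators of the
free Lie algebra (a homogeneous monomial of bracket length `k`). -/
inductive IsBracketing {m : ℕ} : ℕ → FreeLieAlgebra (ZMod 2) (Fin m) → Prop
  | of (i : Fin m) : IsBracketing 1 (FreeLieAlgebra.of (ZMod 2) i)
  | lie {k l : ℕ} {x y : FreeLieAlgebra (ZMod 2) (Fin m)} :
      IsBracketing k x → IsBracketing l y → IsBracketing (k + l) ⁅x, y⁆

/-- The degree-`k` component of the free Lie algebra, graded by bracket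
length. -/
noncomputable def FLdeg (m : ℕ) (k : ℕ) :
    Submodule (ZMod 2) (FreeLieAlgebra (ZMod 2) (Fin m)) :=
  Submodule.span (ZMod 2) {x | IsBracketing k x}

/-- The degree-`k` component of `L_K` (the image of the degree-`k` component
of the free Lie algebra; the relations are homogeneous of degree `2`, so this
is the inherited grading). -/
noncomputable def LKdeg {m : ℕ} (K : Finset (Finset (Fin m))) (k : ℕ) :
    Submodule (ZMod 2) (LK K) :=
  (FLdeg m k).map (LieSubmodule.Quotient.mk' (LKrels K)).toLinearMap

/-- The degree-`k` component `(N_K)_k = N_K ∩ (L_K)_k`. -/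
noncomputable def NKdeg {m : ℕ} (K : Finset (Finset (Fin m))) (k : ℕ) :
    Submodule (ZMod 2) (LK K) :=
  (NK K).toSubmodule ⊓ LKdeg K k

/-- `n_k(K) = dim_{ℤ/2} (N_K)_k`. -/
noncomputable def nDim {m : ℕ} (K : Finset (Finset (Fin m))) (k : ℕ) : ℕ :=
  Module.finrank (ZMod 2) (NKdeg K k)

namespace PBW
open Module

attribute [local instance] LieRing.ofAssociativeRing

variable {R ι L : Type*} [CommRing R] [LieRing L] [LieAlgebra R L]

section ins
variable (b : Basis ι R L)
/-- Insertion of a Lie algebra element between two words. -/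
noncomputable def ins (u v : List ι) : L →ₗ[R] (List ι →₀ R) :=
  b.constr R fun z => Finsupp.single (u ++ z :: v) 1

lemma ins_basis (u v : List ι) (z : ι) : ins b u v (b z) = Finsupp.single (u ++ z :: v) 1 := by
  simp [ins, Basis.constr_basis]

end ins

variable [LinearOrder ι]

/-- The number of inversions of a list. -/
def inv : List ι → ℕ
  | [] => 0
  | a :: l => l.countP (fun c => decide (c < a)) + inv l

lemma inv_swap (u v : List ι) {x y : ι} (h : y < x) :
    inv (u ++ x :: y :: v) = inv (u ++ y :: x :: v) + 1 := by
  induction u with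
  | nil => simp [inv, h, not_lt.mpr h.le]; omega
  | cons a u ih =>
    have : (u ++ x :: y :: v).Perm (u ++ y :: x :: v) :=
      List.Perm.append_left u (List.Perm.swap _ _ _)
    simp only [List.cons_append, inv, ih, this.countP_eq]
    omega

section
variable (b : Basis ι R L)

/-- Rewriting of a word in basis elements as a combination of sorted monomials. -/
noncomputable def red (l : List ι) : Multiset ι →₀ R :=
  open Classical in
  if h : ∃ p : List ι × ι × ι × List ι, l = p.1 ++ p.2.1 :: p.2.2.1 :: p.2.2.2 ∧ p.2.2.1 < p.2.1 then
    red (h.choose.1 ++ h.choose.2.2.1 :: h.choose.2.1 :: h.choose.2.2.2) +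
      (b.repr ⁅b h.choose.2.1, b h.choose.2.2.1⁆).sum fun z c =>
        c • red (h.choose.1 ++ z :: h.choose.2.2.2)
  else Finsupp.single (l : Multiset ι) 1
termination_by (l.length, inv l)
decreasing_by
  · have h1 := h.choose_spec
    have h2 := inv_swap h.choose.1 h.choose.2.2.2 h1.2
    rw [← h1.1] at h2
    have h3 := congrArg List.length h1.1
    simp only [List.length_append, List.length_cons] at h3
    rw [Prod.lex_def]
    right
    simp only [List.length_append, List.length_cons]
    omega
  · have h1 := h.choose_spec
    have h3 := congrArg List.length h1.1
    simp only [List.length_append, List.length_cons] at h3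
    rw [Prod.lex_def]
    left
    simp only [List.length_append, List.length_cons]
    omega

/-- Linear extension of `red`. -/
noncomputable def Red : (List ι →₀ R) →ₗ[R] (Multiset ι →₀ R) := Finsupp.linearCombination R (red b)

lemma Red_ins (u v : List ι) (x : L) :
    Red b (ins b u v x) = (b.repr x).sum fun z c => c • red b (u ++ z :: v) := by
  simp [ins, Red, Basis.constr_apply, Finsupp.sum, map_sum]

lemma Red_ins_basis (u v : List ι) (z : ι) : Red b (ins b u v (b z)) = red b (u ++ z :: v) := by
  simp [ins_basis, Red]

lemma red_sorted {l : List ι} (h : l.Pairwise (· ≤ ·)) :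
    red b l = Finsupp.single (l : Multiset ι) 1 := by
  rw [red, dif_neg]
  rintro ⟨⟨u, x, y, v⟩, rfl, h2⟩
  simp only [List.pairwise_append, List.pairwise_cons] at h
  exact absurd (h.2.1.1 y (by simp)) (not_le.mpr h2)

/-- The straightening identity for all words of length `n`. -/
def Good (n : ℕ) : Prop :=
  ∀ u v x y, (u ++ x :: y :: v).length = n →
    red b (u ++ x :: y :: v) = red b (u ++ y :: x :: v) + Red b (ins b u v ⁅b x, b y⁆)

lemma Good.left {n : ℕ} (h : Good b n) (u v : List ι) (x : L) (y : ι)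
    (hn : u.length + v.length + 2 = n) :
    Red b (ins b u (y :: v) x) = Red b (ins b (u ++ [y]) v x) + Red b (ins b u v ⁅x, b y⁆) := by
  have : (Red b ∘ₗ ins b u (y :: v)) = Red b ∘ₗ ins b (u ++ [y]) v +
      Red b ∘ₗ ins b u v ∘ₗ (-(LieAlgebra.ad R L (b y))) := by
    refine b.ext fun z => ?_
    have := h u v z y (by simp; omega)
    simp only [LinearMap.comp_apply, LinearMap.add_apply, Red_ins_basis, this]
    simp
  have := congrArg (fun f => f x) this
  rw [← lie_skew x, map_neg, map_neg]
  simpa using this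

lemma Good.apart_left {n : ℕ} (h : Good b n) (u m v : List ι) (a : L) (x y : ι)
    (hn : u.length + m.length + v.length + 3 = n) :
    Red b (ins b u (m ++ x :: y :: v) a) = Red b (ins b u (m ++ y :: x :: v) a) +
      b.constr R (fun z => Red b (ins b (u ++ z :: m) v ⁅b x, b y⁆)) a := by
  have : (Red b ∘ₗ ins b u (m ++ x :: y :: v)) = Red b ∘ₗ ins b u (m ++ y :: x :: v) +
      b.constr R (fun z => Red b (ins b (u ++ z :: m) v ⁅b x, b y⁆)) := by
    refine b.ext fun z => ?_
    have := h (u ++ z :: m) v x y (by simp; omega)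
    simp only [LinearMap.comp_apply, LinearMap.add_apply, Red_ins_basis, Basis.constr_basis]
    simpa using this
  exact congrArg (fun f => f a) this

lemma Good.apart_right {n : ℕ} (h : Good b n) (u m v : List ι) (a : L) (x y : ι)
    (hn : u.length + m.length + v.length + 3 = n) :
    Red b (ins b (u ++ x :: y :: m) v a) = Red b (ins b (u ++ y :: x :: m) v a) +
      b.constr R (fun z => Red b (ins b u (m ++ z :: v) ⁅b x, b y⁆)) a := by
  have : (Red b ∘ₗ ins b (u ++ x :: y :: m) v) = Red b ∘ₗ ins b (u ++ y :: x :: m) v +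
      b.constr R (fun z => Red b (ins b u (m ++ z :: v) ⁅b x, b y⁆)) := by
    refine b.ext fun z => ?_
    have := h u (m ++ z :: v) x y (by simp; omega)
    simp only [LinearMap.comp_apply, LinearMap.add_apply, Red_ins_basis, Basis.constr_basis]
    simpa using this
  exact congrArg (fun f => f a) this

lemma constr_constr_comm (u m v : List ι) (a c : L) :
    b.constr R (fun z => Red b (ins b (u ++ z :: m) v c)) a =
      b.constr R (fun z => Red b (ins b u (m ++ z :: v) a)) c := by
  simp only [Basis.constr_apply, Red_ins, Finsupp.sum, Finset.smul_sum]
  rw [Finset.sum_comm]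
  refine Finset.sum_congr rfl fun z _ => Finset.sum_congr rfl fun w _ => ?_
  rw [smul_comm]
  simp

lemma apart {n k : ℕ} (hn : ∀ j < n, Good b j)
    (hk : ∀ u v x y, y < x → (u ++ x :: y :: v).length = n → inv (u ++ x :: y :: v) < k →
      red b (u ++ x :: y :: v) = red b (u ++ y :: x :: v) + Red b (ins b u v ⁅b x, b y⁆))
    (u m v : List ι) (x y x' y' : ι) (h : y < x) (h' : y' < x')
    (hl : (u ++ x :: y :: (m ++ x' :: y' :: v)).length = n)
    (hi : inv (u ++ x :: y :: (m ++ x' :: y' :: v)) = k) :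
    red b (u ++ y :: x :: (m ++ x' :: y' :: v)) + Red b (ins b u (m ++ x' :: y' :: v) ⁅b x, b y⁆) =
    red b (u ++ x :: y :: (m ++ y' :: x' :: v)) + Red b (ins b (u ++ x :: y :: m) v ⁅b x', b y'⁆) := by
  have e1 := inv_swap u (m ++ x' :: y' :: v) h
  have e2 := inv_swap (u ++ x :: y :: m) v h'
  simp only [List.append_assoc, List.cons_append] at e2
  have a1 := hk (u ++ y :: x :: m) v x' y' h' (by simp at hl ⊢; omega) (by simp; omega)
  have a2 := hk u (m ++ y' :: x' :: v) x y h (by simp at hl ⊢; omega) (by omega)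
  simp only [List.length_append, List.length_cons] at hl
  have a3 := (hn (n - 1) (by omega)).apart_left b u m v ⁅b x, b y⁆ x' y' (by omega)
  have a4 := (hn (n - 1) (by omega)).apart_right b u m v ⁅b x', b y'⁆ x y (by omega)
  simp only [List.append_assoc, List.cons_append] at a1
  rw [a1, a2, a3, a4, constr_constr_comm]
  abel

lemma overlap {n k : ℕ} (hn : ∀ j < n, Good b j)
    (hk : ∀ u v x y, y < x → (u ++ x :: y :: v).length = n → inv (u ++ x :: y :: v) < k →
      red b (u ++ x :: y :: v) = red b (u ++ y :: x :: v) + Red b (ins b u v ⁅b x, b y⁆))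
    (u v : List ι) (x y z : ι) (h : y < x) (h' : z < y)
    (hl : (u ++ x :: y :: z :: v).length = n)
    (hi : inv (u ++ x :: y :: z :: v) = k) :
    red b (u ++ y :: x :: z :: v) + Red b (ins b u (z :: v) ⁅b x, b y⁆) =
    red b (u ++ x :: z :: y :: v) + Red b (ins b (u ++ [x]) v ⁅b y, b z⁆) := by
  have e1 := inv_swap u (z :: v) h
  have e2 := inv_swap (u ++ [x]) v h'
  have e3 := inv_swap (u ++ [y]) v (h'.trans h)
  have e4 := inv_swap u (y :: v) (h'.trans h)
  simp only [List.append_assoc, List.cons_append, List.nil_append] at e2 e3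
  have a1 := hk (u ++ [y]) v x z (h'.trans h) (by simp at hl ⊢; omega) (by simp; omega)
  have a2 := hk u (x :: v) y z h' (by simp at hl ⊢; omega) (by omega)
  have a3 := hk u (y :: v) x z (h'.trans h) (by simp at hl ⊢; omega) (by omega)
  have a4 := hk (u ++ [z]) v x y h (by simp at hl ⊢; omega) (by simp; omega)
  simp only [List.append_assoc, List.cons_append, List.nil_append] at a1 a4
  simp only [List.length_append, List.length_cons] at hl
  have g := hn (n - 1) (by omega)
  have c1 := g.left b u v ⁅b x, b y⁆ z (by omega)
  have c2 := g.left b u v ⁅b y, b z⁆ x (by omega)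
  have c3 := g.left b u v ⁅b x, b z⁆ y (by omega)
  rw [a1, a2, a3, a4, c1, c2, c3]
  have J : ⁅⁅b x, b y⁆, b z⁆ + ⁅⁅b y, b z⁆, b x⁆ = ⁅⁅b x, b z⁆, b y⁆ := by
    have := lie_jacobi (b x) (b y) (b z)
    rw [← lie_skew ⁅b x, b y⁆, ← lie_skew ⁅b y, b z⁆, ← lie_skew ⁅b x, b z⁆, ← lie_skew (b x) (b z),
      lie_neg]
    have h3 := congrArg Neg.neg this
    rw [neg_add, neg_add, neg_zero] at h3
    rw [neg_neg, ← sub_eq_zero, ← h3]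
    abel
  rw [← J, map_add, map_add]
  abel

lemma red_eq_of_descent (n k : ℕ) (hn : ∀ j < n, Good b j) : ∀ u v x y, y < x →
    (u ++ x :: y :: v).length = n → inv (u ++ x :: y :: v) = k →
      red b (u ++ x :: y :: v) = red b (u ++ y :: x :: v) + Red b (ins b u v ⁅b x, b y⁆) := by
  induction k using Nat.strong_induction_on with
  | _ k ih =>
  have hk : ∀ u v x y, y < x → (u ++ x :: y :: v).length = n → inv (u ++ x :: y :: v) < k →
      red b (u ++ x :: y :: v) = red b (u ++ y :: x :: v) + Red b (ins b u v ⁅b x, b y⁆) :=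
    fun u v x y h1 h2 h3 => ih _ h3 u v x y h1 h2 rfl
  intro u v x y h hl hi
  have hex : ∃ p : List ι × ι × ι × List ι,
      u ++ x :: y :: v = p.1 ++ p.2.1 :: p.2.2.1 :: p.2.2.2 ∧ p.2.2.1 < p.2.1 :=
    ⟨(u, x, y, v), rfl, h⟩
  rw [red, dif_pos hex, ← Red_ins]
  obtain ⟨he, h'⟩ := hex.choose_spec
  generalize hex.choose = p at he h' ⊢
  obtain ⟨u', x', y', v'⟩ := p
  simp only at he h' ⊢
  rw [List.append_eq_append_iff] at he
  rcases he with ⟨as, rfl, e⟩ | ⟨as, rfl, e⟩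
  · match as with
    | [] => simp only [List.nil_append, List.cons.injEq] at e; obtain ⟨rfl, rfl, rfl⟩ := e; simp
    | [c] =>
      simp at e; obtain ⟨rfl, rfl, rfl⟩ := e
      rw [overlap b hn hk u v' x y y' h h' hl hi]
      simp
    | c :: d :: as =>
      simp at e; obtain ⟨rfl, rfl, rfl⟩ := e
      rw [apart b hn hk u as v' x y x' y' h h' hl hi]
      simp
  · match as with
    | [] => simp only [List.nil_append, List.cons.injEq] at e; obtain ⟨rfl, rfl, rfl⟩ := e; simp
    | [c] =>
      simp at e; obtain ⟨rfl, rfl, rfl⟩ := e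
      rw [overlap b hn hk u' v _ _ _ h' h (by simpa using hl) (by simpa using hi)]
      simp
    | c :: d :: as =>
      simp at e; obtain ⟨rfl, rfl, rfl⟩ := e
      rw [apart b hn hk u' as v x' y' x y h' h (by simpa using hl) (by simpa using hi)]
      simp

lemma good (n : ℕ) : Good b n := by
  induction n using Nat.strong_induction_on with
  | _ n ih =>
  intro u v x y hl
  rcases lt_trichotomy y x with h | rfl | h
  · exact red_eq_of_descent b n _ ih u v x y h hl rfl
  · simp
  · rw [red_eq_of_descent b n _ ih u v y x h (by simpa using hl) rfl, ← lie_skew (b y), add_assoc,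
      map_neg, map_neg, neg_add_cancel, add_zero]

/-- The relations of the universal enveloping algebra, as a subspace of the span of words. -/
noncomputable def relations : Submodule R (List ι →₀ R) :=
  Submodule.span R {z | ∃ u v x y, z = Finsupp.single (u ++ x :: y :: v) 1 -
    Finsupp.single (u ++ y :: x :: v) 1 - ins b u v ⁅b x, b y⁆}

lemma relations_le_ker : relations b ≤ LinearMap.ker (Red b) := by
  rw [relations, Submodule.span_le]
  rintro _ ⟨u, v, x, y, rfl⟩
  have := good b _ u v x y rfl
  simp only [SetLike.mem_coe, LinearMap.mem_ker, map_sub]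
  simp [Red, this]

omit [LinearOrder ι] in
lemma relations_le_comap (z : ι) :
    relations b ≤ (relations b).comap (Finsupp.lmapDomain R R (List.cons z)) := by
  rw [relations, Submodule.span_le]
  rintro _ ⟨u, v, x, y, rfl⟩
  refine Submodule.subset_span ⟨z :: u, v, x, y, ?_⟩
  have : (Finsupp.lmapDomain R R (List.cons z)) ∘ₗ ins b u v = ins b (z :: u) v := by
    refine b.ext fun w => ?_
    simp [ins_basis]
  rw [map_sub, map_sub, ← LinearMap.comp_apply, this]
  simp

/-- Left multiplication by Lie algebra elements on words modulo relations. -/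
noncomputable def leftMul : L →ₗ[R] Module.End R ((List ι →₀ R) ⧸ relations b) :=
  b.constr R fun z => (relations b).mapQ (relations b) _ (relations_le_comap b z)

omit [LinearOrder ι] in
lemma leftMul_basis_mk (z : ι) (l : List ι) :
    leftMul b (b z) ((relations b).mkQ (Finsupp.single l 1)) =
      (relations b).mkQ (Finsupp.single (z :: l) 1) := by
  simp [leftMul, Basis.constr_basis]

omit [LinearOrder ι] in
lemma leftMul_mk (x : L) (l : List ι) :
    leftMul b x ((relations b).mkQ (Finsupp.single l 1)) =
      (relations b).mkQ (ins b [] l x) := by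
  have : (LinearMap.applyₗ ((relations b).mkQ (Finsupp.single l 1))) ∘ₗ leftMul b =
      (relations b).mkQ ∘ₗ ins b [] l := by
    refine b.ext fun w => ?_
    simp only [LinearMap.comp_apply, LinearMap.applyₗ_apply_apply, leftMul_basis_mk, ins_basis]
    rfl
  exact congrArg (fun f => f x) this

omit [LinearOrder ι] in
lemma leftMul_lie (x y : L) : leftMul b ⁅x, y⁆ = ⁅leftMul b x, leftMul b y⁆ := by
  have : (LieModule.toEnd R L L : L →ₗ[R] Module.End R L).compr₂ (leftMul b) =
      ((LieModule.toEnd R (Module.End R ((List ι →₀ R) ⧸ relations b))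
        (Module.End R ((List ι →₀ R) ⧸ relations b)) : _ →ₗ[R] Module.End R _).compl₁₂
        (leftMul b) (leftMul b)) := by
    refine b.ext fun z => b.ext fun w => ?_
    refine Submodule.linearMap_qext _ (Finsupp.lhom_ext' fun l => LinearMap.ext_ring ?_)
    simp only [LinearMap.comp_apply, LinearMap.compr₂_apply, LinearMap.compl₁₂_apply,
      LieHom.coe_toLinearMap, LieModule.toEnd_apply_apply, Finsupp.lsingle_apply]
    rw [leftMul_mk, LieRing.of_associative_ring_bracket, LinearMap.sub_apply, Module.End.mul_apply,
      Module.End.mul_apply, leftMul_basis_mk, leftMul_basis_mk, leftMul_basis_mk, leftMul_basis_mk]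
    rw [← map_sub, eq_comm, ← sub_eq_zero, ← map_sub, Submodule.mkQ_apply,
      Submodule.Quotient.mk_eq_zero]
    exact Submodule.subset_span ⟨[], l, z, w, rfl⟩
  exact congrArg (fun f => f x y) this

/-- `leftMul` as a morphism of Lie algebras. -/
noncomputable def leftMulHom : L →ₗ⁅R⁆ Module.End R ((List ι →₀ R) ⧸ relations b) :=
  { leftMul b with map_lie' := fun {x y} => leftMul_lie b x y }

/-- The monomial of the universal enveloping algebra given by a word in basis elements. -/
noncomputable def mono (l : List ι) : UniversalEnvelopingAlgebra R L :=
  (l.map fun i => UniversalEnvelopingAlgebra.ι R (b i)).prod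

/-- The linear independence half of the Poincaré–Birkhoff–Witt theorem. -/
theorem linearIndependent_mono :
    LinearIndependent R fun s : Multiset ι => mono b s.sort := by
  let φ : UniversalEnvelopingAlgebra R L →ₗ[R] (Multiset ι →₀ R) :=
    (relations b).liftQ (Red b) (relations_le_ker b) ∘ₗ
      LinearMap.applyₗ ((relations b).mkQ (Finsupp.single [] 1)) ∘ₗ
        (UniversalEnvelopingAlgebra.lift R (leftMulHom b)).toLinearMap
  have hmono (l : List ι) : UniversalEnvelopingAlgebra.lift R (leftMulHom b) (mono b l)
      ((relations b).mkQ (Finsupp.single [] 1)) = (relations b).mkQ (Finsupp.single l 1) := by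
    induction l with
    | nil => simp [mono]
    | cons z l ih =>
      have : mono b (z :: l) = UniversalEnvelopingAlgebra.ι R (b z) * mono b l := by simp [mono]
      rw [this, map_mul, Module.End.mul_apply, ih, UniversalEnvelopingAlgebra.lift_ι_apply]
      exact leftMul_basis_mk b z l
  refine LinearIndependent.of_comp φ ?_
  convert (Finsupp.basisSingleOne (R := R) (ι := Multiset ι)).linearIndependent using 1
  ext1 s
  simp only [φ, Function.comp_apply, LinearMap.comp_apply, AlgHom.toLinearMap_apply,
    LinearMap.applyₗ_apply_apply, hmono]
  rw [Submodule.mkQ_apply, Submodule.liftQ_apply]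
  simp [Red, red_sorted b (Multiset.pairwise_sort s _)]

theorem ι_injective [Nontrivial R] (b : Basis ι R L) :
    Function.Injective (UniversalEnvelopingAlgebra.ι R (L := L)) := by
  have h := (linearIndependent_mono b).comp (fun i => ({i} : Multiset ι))
    (fun i j h => by simpa using h)
  have h2 : (fun s : Multiset ι => mono b s.sort) ∘ (fun i => ({i} : Multiset ι)) =
      (UniversalEnvelopingAlgebra.ι R (L := L)).toLinearMap ∘ b := by
    ext1 i; simp [mono]
  rw [h2] at h
  intro x y hxy
  refine b.repr.injective (h ?_)
  rw [Finsupp.linearCombination_linear_comp]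
  simpa [Finsupp.apply_linearCombination] using hxy

end
end PBW

namespace PBW

section span
variable {R ι A : Type*} [CommRing R] [Ring A] [Algebra R A] (e : ι → A)

/-- The span of products of words of length at most `n`. -/
def wordSpan (n : ℕ) : Submodule R A :=
  Submodule.span R {z | ∃ l : List ι, l.length ≤ n ∧ z = (l.map e).prod}

lemma wordSpan_mono {n m : ℕ} (h : n ≤ m) : wordSpan (R := R) e n ≤ wordSpan e m :=
  Submodule.span_mono fun _ ⟨l, hl, hz⟩ => ⟨l, hl.trans h, hz⟩

lemma mul_mem_wordSpan {n : ℕ} {x y : A} (hx : x ∈ Submodule.span R (Set.range e))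
    (hy : y ∈ wordSpan (R := R) e n) : x * y ∈ wordSpan (R := R) e (n + 1) := by
  induction hx using Submodule.span_induction with
  | mem x h =>
    obtain ⟨i, rfl⟩ := h
    induction hy using Submodule.span_induction with
    | mem y h =>
      obtain ⟨l, hl, rfl⟩ := h
      exact Submodule.subset_span ⟨i :: l, by simpa using hl, by simp⟩
    | zero => simp
    | add y z _ _ h1 h2 => rw [mul_add]; exact add_mem h1 h2
    | smul c y _ h => rw [mul_smul_comm]; exact Submodule.smul_mem _ _ h
  | zero => simp
  | add y z _ _ h1 h2 => rw [add_mul]; exact add_mem h1 h2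
  | smul c y _ h => rw [smul_mul_assoc]; exact Submodule.smul_mem _ _ h

variable (he : ∀ i j, e i * e j - e j * e i ∈ Submodule.span R (Set.range e))
include he

lemma perm_sub_mem {l l' : List ι} (h : l.Perm l') :
    (l.map e).prod - (l'.map e).prod ∈ wordSpan (R := R) e (l.length - 1) := by
  induction h with
  | nil => simp
  | @cons a l l' h ih =>
    rw [List.map_cons, List.map_cons, List.prod_cons, List.prod_cons, ← mul_sub]
    rcases l with _ | ⟨c, l⟩
    · simp [List.nil_perm.mp h]
    · exact mul_mem_wordSpan e (Submodule.subset_span ⟨a, rfl⟩) ih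
  | swap a b l =>
    have : e b * (e a * (l.map e).prod) - e a * (e b * (l.map e).prod) =
      (e b * e a - e a * e b) * (l.map e).prod := by noncomm_ring
    simp only [List.map_cons, List.prod_cons, this]
    exact mul_mem_wordSpan e (he _ _) (Submodule.subset_span ⟨l, le_rfl, rfl⟩)
  | trans h1 h2 ih1 ih2 =>
    rw [← h1.length_eq] at ih2
    have := add_mem ih1 ih2
    rwa [sub_add_sub_cancel] at this

variable [LinearOrder ι]

lemma wordSpan_le (n : ℕ) : wordSpan (R := R) e n ≤
    Submodule.span R (Set.range fun s : Multiset ι => (s.sort.map e).prod) := by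
  induction n with
  | zero =>
    refine Submodule.span_le.mpr ?_
    rintro _ ⟨l, hl, rfl⟩
    obtain rfl : l = [] := by simpa using hl
    exact Submodule.subset_span ⟨0, by simp⟩
  | succ n ih =>
    refine Submodule.span_le.mpr ?_
    rintro _ ⟨l, hl, rfl⟩
    have hp : l.Perm (l : Multiset ι).sort := by
      rw [← Multiset.coe_eq_coe, Multiset.sort_eq]
    have h := ih (wordSpan_mono e (by omega) (perm_sub_mem (R := R) e he hp))
    have := add_mem h (Submodule.subset_span (R := R)
      (Set.mem_range_self (f := fun s : Multiset ι => (s.sort.map e).prod) (l : Multiset ι)))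
    simpa using this

lemma mul_mem_span_sorted {x y : A} (hx : x ∈ Submodule.span R (Set.range e))
    (hy : y ∈ Submodule.span R (Set.range fun s : Multiset ι => (s.sort.map e).prod)) :
    x * y ∈ Submodule.span R (Set.range fun s : Multiset ι => (s.sort.map e).prod) := by
  induction hy using Submodule.span_induction with
  | mem y h =>
    obtain ⟨s, rfl⟩ := h
    exact wordSpan_le e he _ (mul_mem_wordSpan e hx (Submodule.subset_span ⟨_, le_rfl, rfl⟩))
  | zero => simp
  | add y z _ _ h1 h2 => rw [mul_add]; exact add_mem h1 h2
  | smul c y _ h => rw [mul_smul_comm]; exact Submodule.smul_mem _ _ h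

end span
end PBW

namespace GradedCount
open PowerSeries

variable {α β : Type*}

/-- All fibres of the degree function are finite. -/
def FinFib (deg : α → ℕ) : Prop := ∀ d, Finite {a // deg a = d}

/-- The generating function counting elements by degree. -/
noncomputable def gf (deg : α → ℕ) : PowerSeries ℤ :=
  PowerSeries.mk fun d => (Nat.card {a // deg a = d} : ℤ)

lemma FinFib.equiv {f : α → ℕ} {g : β → ℕ} (e : α ≃ β) (h : ∀ a, g (e a) = f a)
    (hf : FinFib f) : FinFib g := fun d =>
  have := hf d
  Finite.of_equiv _ (e.subtypeEquiv (p := fun a => f a = d) (q := fun b => g b = d)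
    (fun a => by rw [h]))

lemma gf_equiv {f : α → ℕ} {g : β → ℕ} (e : α ≃ β) (h : ∀ a, g (e a) = f a) : gf g = gf f := by
  ext d
  simp only [gf, coeff_mk]
  rw [Nat.card_congr (e.subtypeEquiv (p := fun a => f a = d) (q := fun b => g b = d)
    (fun a => by rw [h]))]

/-- Pairs of total degree `d`. -/
def prodFibEquiv (f : α → ℕ) (g : β → ℕ) (d : ℕ) :
    {p : α × β // f p.1 + g p.2 = d} ≃
      Σ x : Finset.HasAntidiagonal.antidiagonal d, {a // f a = x.1.1} × {b // g b = x.1.2} where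
  toFun p := ⟨⟨(f p.1.1, g p.1.2), by simpa using p.2⟩, ⟨p.1.1, rfl⟩, ⟨p.1.2, rfl⟩⟩
  invFun x := ⟨(x.2.1.1, x.2.2.1), by
    have := x.1.2; rw [Finset.HasAntidiagonal.mem_antidiagonal] at this
    rw [x.2.1.2, x.2.2.2, this]⟩
  left_inv p := rfl
  right_inv x := by
    obtain ⟨⟨⟨i, j⟩, hx⟩, ⟨a, ha⟩, ⟨b, hb⟩⟩ := x
    dsimp only at ha hb
    subst ha hb
    rfl

lemma FinFib.prod {f : α → ℕ} {g : β → ℕ} (hf : FinFib f) (hg : FinFib g) :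
    FinFib fun p : α × β => f p.1 + g p.2 := fun d => by
  have := fun i => hf i
  have := fun i => hg i
  exact Finite.of_equiv _ (prodFibEquiv f g d).symm

lemma gf_prod {f : α → ℕ} {g : β → ℕ} (hf : FinFib f) (hg : FinFib g) :
    gf (fun p : α × β => f p.1 + g p.2) = gf f * gf g := by
  have := fun i => hf i
  have := fun i => hg i
  ext d
  simp only [gf, coeff_mk, coeff_mul]
  rw [Nat.card_congr (prodFibEquiv f g d), Nat.card_sigma,
    ← Finset.sum_coe_sort (Finset.HasAntidiagonal.antidiagonal d)]
  push_cast [Nat.card_prod]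
  rfl

lemma gf_sum {f : α → ℕ} {g : β → ℕ} (hf : FinFib f) (hg : FinFib g) :
    gf (Sum.elim f g) = gf f + gf g := by
  ext d
  have : Finite {a // Sum.elim f g (Sum.inl a) = d} := hf d
  have : Finite {a // Sum.elim f g (Sum.inr a) = d} := hg d
  simp only [gf, coeff_mk, map_add]
  rw [Nat.card_congr (Equiv.subtypeSum (p := fun x => Sum.elim f g x = d)), Nat.card_sum]
  push_cast
  rfl

lemma FinFib.subtype {f : α → ℕ} (hf : FinFib f) (p : α → Prop) :
    FinFib fun a : {a // p a} => f a := fun d => by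
  have := hf d
  exact Finite.of_injective (β := {a // f a = d}) (fun a => ⟨a.1.1, a.2⟩) fun a b h => by
    simpa [Subtype.ext_iff] using h

lemma finFib_unique [Unique α] (f : α → ℕ) : FinFib f := fun _ => inferInstance

lemma gf_unique_zero [Unique α] (f : α → ℕ) (h : f default = 0) : gf f = 1 := by
  ext d
  simp only [gf, coeff_mk, coeff_one]
  split_ifs with hd
  · subst hd
    have : Unique {a // f a = 0} := ⟨⟨⟨default, h⟩⟩, fun a => Subtype.ext (Subsingleton.elim _ _)⟩
    simp
  · have : IsEmpty {a // f a = d} := ⟨fun a => hd (by rw [← a.2, Subsingleton.elim a.1 default, h])⟩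
    simp

lemma finFib_succ {f : α → ℕ} (hf : FinFib f) : FinFib fun a => f a + 1 := fun d => by
  have := hf (d - 1)
  exact Finite.of_injective (β := {a // f a = d - 1}) (fun a => ⟨a.1, by have := a.2; dsimp only at this; omega⟩)
    fun a b h => by simpa [Subtype.ext_iff] using h

lemma gf_succ (f : α → ℕ) : gf (fun a => f a + 1) = X * gf f := by
  ext d
  cases d with
  | zero => simp [gf]
  | succ d => simp [gf, coeff_succ_X_mul]

lemma gf_bool : gf (fun b : Bool => b.toNat) = 1 + X := by
  have h := gf_sum (finFib_unique fun _ : PUnit.{1} => 0) (finFib_unique fun _ : PUnit.{1} => 1)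
  rw [gf_succ (fun _ : PUnit.{1} => 0), gf_unique_zero (fun _ : PUnit.{1} => 0) rfl, mul_one] at h
  rw [← h]
  refine gf_equiv Equiv.boolEquivPUnitSumPUnit.symm ?_
  rintro (_ | _) <;> rfl

lemma finFib_bool : FinFib (fun b : Bool => b.toNat) := fun _ => inferInstance

/-- Removing a point of degree zero. -/
lemma gf_erase {f : α → ℕ} (hf : FinFib f) (a : α) (ha : f a = 0) :
    gf f = 1 + gf (fun x : {x // x ≠ a} => f x) := by
  classical
  have h := gf_sum (hf.subtype (· = a)) (hf.subtype (¬ · = a))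
  rw [gf_unique_zero (fun x : {x // x = a} => f x) (by show f a = 0; exact ha)] at h
  refine Eq.trans ?_ h
  refine gf_equiv (Equiv.sumCompl (· = a)) ?_
  rintro (x | x) <;> rfl

/-- Degree of a word. -/
def listDeg (f : α → ℕ) (l : List α) : ℕ := (l.map f).sum

/-- A word is empty or has a head and a tail. -/
def listEquiv (α : Type*) : List α ≃ PUnit.{1} ⊕ α × List α where
  toFun | [] => Sum.inl ⟨⟩ | a :: l => Sum.inr (a, l)
  invFun | Sum.inl _ => [] | Sum.inr (a, l) => a :: l
  left_inv l := by cases l <;> rfl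
  right_inv x := by rcases x with _ | ⟨a, l⟩ <;> rfl

lemma finFib_list {f : α → ℕ} (hf : FinFib f) (h0 : ∀ a, 0 < f a) : FinFib (listDeg f) := by
  intro d
  induction d using Nat.strong_induction_on with
  | _ d ih =>
  have := fun x : Finset.range d => ih x.1 (Finset.mem_range.mp x.2)
  have := fun i => hf i
  let T := Option (Σ x : Finset.range d, {a // f a = d - x} × {l // listDeg f l = x})
  let φ : T → List α := fun t => t.elim [] fun t => t.2.1.1 :: t.2.2.1
  refine (Set.finite_range φ |>.subset ?_ : Set.Finite {l | listDeg f l = d}).to_subtype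
  rintro (_ | ⟨a, l⟩) hl
  · exact ⟨none, rfl⟩
  · have h1 : f a + listDeg f l = d := by simpa [listDeg] using hl
    have := h0 a
    exact ⟨some ⟨⟨listDeg f l, Finset.mem_range.mpr (by omega)⟩, ⟨a, by simp; omega⟩, ⟨l, rfl⟩⟩, rfl⟩

lemma gf_list {f : α → ℕ} (hf : FinFib f) (h0 : ∀ a, 0 < f a) :
    gf (listDeg f) * (1 - gf f) = 1 := by
  have hl := finFib_list hf h0
  have h := gf_sum (finFib_unique fun _ : PUnit.{1} => 0) (hf.prod hl)
  rw [gf_unique_zero (fun _ : PUnit.{1} => 0) rfl, gf_prod hf hl] at h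
  have e : gf (listDeg f) = 1 + gf f * gf (listDeg f) := by
    rw [← h]
    refine gf_equiv (listEquiv α).symm ?_
    rintro (_ | ⟨a, l⟩) <;> simp [listEquiv, listDeg]
  linear_combination e

lemma finFib_mul {k : ℕ} (hk : 0 < k) : FinFib fun n : ℕ => n * k := fun d =>
  Finite.of_injective (β := Fin (d + 1)) (fun n => ⟨n.1, by
    have := n.2; simp only at this; nlinarith [Nat.le_mul_of_pos_right n.1 hk]⟩)
    fun a b h => by simpa [Subtype.ext_iff] using h

lemma gf_mul {k : ℕ} (hk : 0 < k) : gf (fun n : ℕ => n * k) * (1 - X ^ k) = 1 := by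
  have h := gf_list (finFib_unique fun _ : PUnit.{1} => k) (fun _ => hk)
  have e1 : gf (fun n : ℕ => n * k) = gf (listDeg fun _ : PUnit.{1} => k) := by
    refine gf_equiv (⟨List.length, fun n => List.replicate n ⟨⟩, fun l => ?_, fun n => ?_⟩ :
      List PUnit.{1} ≃ ℕ) ?_
    · exact List.ext_getElem (by simp) fun _ _ _ => rfl
    · simp
    · intro l; simp [listDeg]
  have e2 : gf (fun _ : PUnit.{1} => k) = X ^ k := by
    ext d
    simp only [gf, coeff_mk, coeff_X_pow]
    split_ifs with hd
    · subst hd; simp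
    · have : IsEmpty {a : PUnit.{1} // k = d} := ⟨fun a => hd a.2.symm⟩
      simp
  rwa [e1, ← e2]

lemma gf_fun [Finite α] (f : α → ℕ) (h0 : ∀ a, 0 < f a) : ∀ [Fintype α],
    FinFib (fun n : α → ℕ => ∑ a, n a * f a) ∧
    gf (fun n : α → ℕ => ∑ a, n a * f a) * ∏ a, (1 - X ^ f a) = 1 := by
  induction α using Finite.induction_empty_option with
  | @of_equiv α β e ih =>
    intro _
    have := Fintype.ofEquiv _ e.symm
    obtain ⟨h1, h2⟩ := ih (f ∘ e) (fun a => h0 _)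
    have key : ∀ n : α → ℕ, ∑ b, (e.arrowCongr (Equiv.refl ℕ) n) b * f b =
        ∑ a, n a * (f ∘ e) a := fun n => by
      rw [← e.sum_comp]; simp
    refine ⟨h1.equiv (e.arrowCongr (Equiv.refl ℕ)) key, ?_⟩
    rw [gf_equiv (e.arrowCongr (Equiv.refl ℕ)) key, ← e.prod_comp]
    exact h2
  | h_empty =>
    intro _
    refine ⟨finFib_unique _, ?_⟩
    rw [gf_unique_zero _ (by simp)]
    simp
  | @h_option α _ ih =>
    intro inst
    obtain rfl : inst = instFintypeOption := Subsingleton.elim _ _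
    obtain ⟨h1, h2⟩ := ih (f ∘ some) (fun a => h0 _)
    have key : ∀ n : ℕ × (α → ℕ), ∑ b, ((Equiv.piOptionEquivProd (β := fun _ => ℕ)).symm n) b * f b =
        n.1 * f none + ∑ a, n.2 a * (f ∘ some) a := fun n => by
      rw [Fintype.sum_option]
      rfl
    have hf := (finFib_mul (h0 none)).prod h1
    refine ⟨hf.equiv Equiv.piOptionEquivProd.symm key, ?_⟩
    rw [gf_equiv Equiv.piOptionEquivProd.symm key, gf_prod (finFib_mul (h0 none)) h1]
    have e : ∏ a, (1 - X ^ f a : PowerSeries ℤ) =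
        (1 - X ^ f none) * ∏ a, (1 - X ^ (f ∘ some) a) := by
      rw [Fintype.prod_option]
      rfl
    rw [e]
    linear_combination (gf fun n : α → ℕ => ∑ a, n a * (f ∘ some) a) *
      (∏ a, (1 - X ^ (f ∘ some) a)) * gf_mul (h0 none) + h2

end GradedCount

namespace PolyRep

variable (𝕜 : Type*) [Field 𝕜] {V : Type*} (A : V → V → Prop) (J S : Finset V)

/-- The relations of the cyclic module `W`. -/
def rel : Submodule 𝕜 (FreeAlgebra 𝕜 V) :=
  Submodule.span 𝕜
    ({z | ∃ a b i j, A i j ∧ z = a * ((FreeAlgebra.ι 𝕜 i * FreeAlgebra.ι 𝕜 j -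
        FreeAlgebra.ι 𝕜 j * FreeAlgebra.ι 𝕜 i) * b)} ∪
      {z | ∃ a b i, i ∉ J ∧ z = a * (FreeAlgebra.ι 𝕜 i * b)} ∪
      {z | ∃ a, ∃ s ∈ S, z = a * FreeAlgebra.ι 𝕜 s})

/-- The cyclic module over the right-angled Artin algebra on the vertices in `J`, with the
generators in `S` killing the cyclic vector. -/
def W : Type _ := FreeAlgebra 𝕜 V ⧸ rel 𝕜 A J S

noncomputable instance : AddCommGroup (W 𝕜 A J S) :=
  inferInstanceAs (AddCommGroup (FreeAlgebra 𝕜 V ⧸ rel 𝕜 A J S))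

noncomputable instance : Module 𝕜 (W 𝕜 A J S) :=
  inferInstanceAs (Module 𝕜 (FreeAlgebra 𝕜 V ⧸ rel 𝕜 A J S))

/-- The quotient map. -/
noncomputable def toW : FreeAlgebra 𝕜 V →ₗ[𝕜] W 𝕜 A J S := (rel 𝕜 A J S).mkQ

/-- The cyclic vector. -/
noncomputable def one : W 𝕜 A J S := toW 𝕜 A J S 1

variable {𝕜 A J S}

/-- Operators on a space with a distinguished vector which satisfy the relations of `W`. -/
structure IsRep {P : Type*} [AddCommGroup P] [Module 𝕜 P] (A : V → V → Prop) (J S : Finset V)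
    (X : V → Module.End 𝕜 P) (p : P) : Prop where
  comm : ∀ i j, A i j → X i * X j = X j * X i
  zero : ∀ i, i ∉ J → X i = 0
  kill : ∀ s ∈ S, X s p = 0

lemma mul_mem_rel (c : FreeAlgebra 𝕜 V) {z} (hz : z ∈ rel 𝕜 A J S) :
    c * z ∈ rel 𝕜 A J S := by
  have : rel 𝕜 A J S ≤ (rel 𝕜 A J S).comap (LinearMap.mulLeft 𝕜 c) := by
    refine Submodule.span_le.mpr ?_
    rintro _ ((⟨a, b, i, j, h, rfl⟩ | ⟨a, b, i, h, rfl⟩) | ⟨a, s, h, rfl⟩) <;>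
      refine Submodule.subset_span ?_ <;>
      rw [LinearMap.mulLeft_apply, ← mul_assoc]
    · exact Or.inl (Or.inl ⟨c * a, b, i, j, h, rfl⟩)
    · exact Or.inl (Or.inr ⟨c * a, b, i, h, rfl⟩)
    · exact Or.inr ⟨c * a, s, h, rfl⟩
  exact this hz

variable (𝕜 A J S) in
/-- The action of the generators. -/
noncomputable def op (i : V) : Module.End 𝕜 (W 𝕜 A J S) :=
  (rel 𝕜 A J S).mapQ (rel 𝕜 A J S) (LinearMap.mulLeft 𝕜 (FreeAlgebra.ι 𝕜 i))
    fun _ hz => mul_mem_rel _ hz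

lemma op_toW (i : V) (a : FreeAlgebra 𝕜 V) :
    op 𝕜 A J S i (toW 𝕜 A J S a) = toW 𝕜 A J S (FreeAlgebra.ι 𝕜 i * a) := rfl

lemma toW_surjective : Function.Surjective (toW 𝕜 A J S) := Submodule.mkQ_surjective _

lemma toW_eq_zero {z} (hz : z ∈ rel 𝕜 A J S) : toW 𝕜 A J S z = 0 :=
  (Submodule.Quotient.mk_eq_zero _).mpr hz

lemma isRep_op : IsRep A J S (op 𝕜 A J S) (one 𝕜 A J S) where
  comm i j h := by
    ext w
    obtain ⟨a, rfl⟩ := toW_surjective w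
    rw [Module.End.mul_apply, Module.End.mul_apply, op_toW, op_toW, op_toW, op_toW, ← sub_eq_zero,
      ← map_sub]
    refine toW_eq_zero (Submodule.subset_span (Or.inl (Or.inl ⟨1, a, i, j, h, ?_⟩)))
    noncomm_ring
  zero i h := by
    ext w
    obtain ⟨a, rfl⟩ := toW_surjective w
    rw [op_toW]
    exact toW_eq_zero (Submodule.subset_span (Or.inl (Or.inr ⟨1, a, i, h, by simp⟩)))
  kill s h := by
    rw [one, op_toW]
    exact toW_eq_zero (Submodule.subset_span (Or.inr ⟨1, s, h, by simp⟩))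

section lift
variable {P : Type*} [AddCommGroup P] [Module 𝕜 P] {X : V → Module.End 𝕜 P} {p : P}

/-- The universal property of `W`. -/
noncomputable def lift (h : IsRep A J S X p) : W 𝕜 A J S →ₗ[𝕜] P :=
  (rel 𝕜 A J S).liftQ ((LinearMap.applyₗ p).comp (FreeAlgebra.lift 𝕜 X).toLinearMap) <| by
    refine Submodule.span_le.mpr ?_
    rintro _ ((⟨a, b, i, j, hij, rfl⟩ | ⟨a, b, i, hi, rfl⟩) | ⟨a, s, hs, rfl⟩)
    · simp [h.comm i j hij]
    · simp [h.zero i hi]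
    · simp [h.kill s hs]

lemma lift_toW (h : IsRep A J S X p) (a : FreeAlgebra 𝕜 V) :
    lift h (toW 𝕜 A J S a) = FreeAlgebra.lift 𝕜 X a p := rfl

@[simp] lemma lift_one (h : IsRep A J S X p) : lift h (one 𝕜 A J S) = p := by
  rw [one, lift_toW]; simp

@[simp] lemma lift_op (h : IsRep A J S X p) (i : V) (w : W 𝕜 A J S) :
    lift h (op 𝕜 A J S i w) = X i (lift h w) := by
  obtain ⟨a, rfl⟩ := toW_surjective w
  rw [op_toW, lift_toW, lift_toW]; simp

end lift

/-- A subspace containing the cyclic vector and stable under the generators is everything. -/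
lemma eq_top_of_stable (U : Submodule 𝕜 (W 𝕜 A J S)) (h1 : one 𝕜 A J S ∈ U)
    (hX : ∀ i, ∀ w ∈ U, op 𝕜 A J S i w ∈ U) : U = ⊤ := by
  have key : ∀ a : FreeAlgebra 𝕜 V, ∀ b, toW 𝕜 A J S b ∈ U → toW 𝕜 A J S (a * b) ∈ U := by
    intro a
    induction a using FreeAlgebra.induction with
    | grade0 r =>
      intro b hb
      rw [← Algebra.smul_def, map_smul]
      exact U.smul_mem _ hb
    | grade1 i => exact fun b hb => hX i _ hb
    | mul x y hx hy =>
      intro b hb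
      rw [mul_assoc]
      exact hx _ (hy _ hb)
    | add x y hx hy =>
      intro b hb
      rw [add_mul, map_add]
      exact U.add_mem (hx _ hb) (hy _ hb)
  refine eq_top_iff.mpr fun w _ => ?_
  obtain ⟨a, rfl⟩ := toW_surjective w
  simpa using key a 1 h1

/-- Linear maps that agree on the cyclic vector and intertwine the generators agree. -/
lemma linearMap_ext {P : Type*} [AddCommGroup P] [Module 𝕜 P] {f g : W 𝕜 A J S →ₗ[𝕜] P}
    (h1 : f (one 𝕜 A J S) = g (one 𝕜 A J S))
    (hX : ∀ i w, f w = g w → f (op 𝕜 A J S i w) = g (op 𝕜 A J S i w)) : f = g := by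
  have : LinearMap.eqLocus f g = ⊤ := eq_top_of_stable _ h1 hX
  ext w
  exact LinearMap.mem_eqLocus.mp (this ▸ Submodule.mem_top)

/-- Monomials in `W`. -/
noncomputable def wd (l : List V) : W 𝕜 A J S := l.foldr (fun i w => op 𝕜 A J S i w) (one 𝕜 A J S)

@[simp] lemma wd_nil : (wd [] : W 𝕜 A J S) = one 𝕜 A J S := rfl
@[simp] lemma wd_cons (i : V) (l : List V) :
    (wd (i :: l) : W 𝕜 A J S) = op 𝕜 A J S i (wd l) := rfl

variable (𝕜 A J S) in
/-- The homogeneous component of degree `d`. -/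
noncomputable def Wd (d : ℕ) : Submodule 𝕜 (W 𝕜 A J S) :=
  Submodule.span 𝕜 {w | ∃ l : List V, l.length = d ∧ w = wd l}

lemma wd_mem_Wd (l : List V) : (wd l : W 𝕜 A J S) ∈ Wd 𝕜 A J S l.length :=
  Submodule.subset_span ⟨l, rfl, rfl⟩

lemma one_mem_Wd : one 𝕜 A J S ∈ Wd 𝕜 A J S 0 := wd_mem_Wd []

lemma op_mem_Wd (i : V) {d : ℕ} {w} (hw : w ∈ Wd 𝕜 A J S d) :
    op 𝕜 A J S i w ∈ Wd 𝕜 A J S (d + 1) := by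
  induction hw using Submodule.span_induction with
  | mem w h =>
    obtain ⟨l, rfl, rfl⟩ := h
    exact wd_mem_Wd (i :: l)
  | zero => simp
  | add x y _ _ hx hy => rw [map_add]; exact add_mem hx hy
  | smul c x _ hx => rw [map_smul]; exact Submodule.smul_mem _ _ hx

variable (𝕜 A J S) in
/-- The operators shifting the degree. -/
noncomputable def shiftOp (i : V) : Module.End 𝕜 (ℕ →₀ W 𝕜 A J S) :=
  (Finsupp.lmapDomain _ 𝕜 Nat.succ).comp (Finsupp.mapRange.linearMap (op 𝕜 A J S i))

lemma shiftOp_single (i : V) (d : ℕ) (w) :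
    shiftOp 𝕜 A J S i (Finsupp.single d w) = Finsupp.single (d + 1) (op 𝕜 A J S i w) := by
  simp [shiftOp]

lemma isRep_shiftOp : IsRep A J S (shiftOp 𝕜 A J S) (Finsupp.single 0 (one 𝕜 A J S)) where
  comm i j h := by
    refine Finsupp.lhom_ext fun d w => ?_
    simp only [Module.End.mul_apply, shiftOp_single]
    rw [← Module.End.mul_apply, isRep_op.comm i j h, Module.End.mul_apply]
  zero i h := by
    refine Finsupp.lhom_ext fun d w => ?_
    simp [shiftOp_single, isRep_op.zero i h]
  kill s h := by
    rw [shiftOp_single, isRep_op.kill s h, Finsupp.single_zero]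

variable (𝕜 A J S) in
/-- The projection to degree `d`. -/
noncomputable def pr (d : ℕ) : Module.End 𝕜 (W 𝕜 A J S) :=
  (Finsupp.lapply d).comp (lift isRep_shiftOp)

lemma lift_shiftOp_wd (l : List V) :
    lift isRep_shiftOp (wd l : W 𝕜 A J S) = Finsupp.single l.length (wd l) := by
  induction l with
  | nil => simp
  | cons i l ih => rw [wd_cons, lift_op, ih, shiftOp_single]; rfl

lemma pr_of_mem {d : ℕ} {w} (hw : w ∈ Wd 𝕜 A J S d) (e : ℕ) :
    pr 𝕜 A J S e w = if d = e then w else 0 := by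
  classical
  have : w ∈ LinearMap.eqLocus (pr 𝕜 A J S e) (if d = e then LinearMap.id else 0) := by
    refine (Submodule.span_le.mpr ?_ : Wd 𝕜 A J S d ≤ _) hw
    rintro _ ⟨l, rfl, rfl⟩
    simp only [SetLike.mem_coe, LinearMap.mem_eqLocus]
    rw [pr, LinearMap.comp_apply, lift_shiftOp_wd, Finsupp.lapply_apply, Finsupp.single_apply]
    split_ifs <;> rfl
  rw [LinearMap.mem_eqLocus.mp this]
  split_ifs <;> rfl

variable (𝕜 A J S) in
lemma isRep_zero : IsRep A J S (fun _ => (0 : Module.End 𝕜 𝕜)) 1 :=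
  ⟨fun _ _ _ => rfl, fun _ _ => rfl, fun _ _ => rfl⟩

variable (𝕜 A J S) in
/-- The augmentation. -/
noncomputable def aug : W 𝕜 A J S →ₗ[𝕜] 𝕜 := lift (isRep_zero 𝕜 A J S)

@[simp] lemma aug_one : aug 𝕜 A J S (one 𝕜 A J S) = 1 := lift_one _
@[simp] lemma aug_op (i w) : aug 𝕜 A J S (op 𝕜 A J S i w) = 0 := lift_op _ _ _

end PolyRep

namespace PolyRep

variable {𝕜 : Type*} [Field 𝕜] {V : Type*} [DecidableEq V] {A : V → V → Prop}
  {v : V} {J S T : Finset V}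

omit [DecidableEq V] in
lemma sumExtend_inl {ι M : Type*} [AddCommGroup M] [Module 𝕜 M] {c : ι → M}
    (hc : LinearIndependent 𝕜 c) (i : ι) : Module.Basis.sumExtend hc (Sum.inl i) = c i := by
  classical
  simp only [Module.Basis.sumExtend, Module.Basis.reindex_apply, Module.Basis.extend_apply_self]
  exact congrArg Subtype.val (Equiv.Set.sumDiffSubset_apply_inl
    (hc.linearIndepOn_id.subset_extend (Set.subset_univ _)) _)

/-- The situation where a vertex `v` with neighbours `T` is added to `J`. -/
structure Setup (A : V → V → Prop) (v : V) (J S T : Finset V) : Prop where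
  symm : ∀ i j, A i j → A j i
  notMem : v ∉ J
  subS : S ⊆ J
  subT : T ⊆ J
  memT : ∀ i ∈ J, A i v → i ∈ T
  adj : ∀ i ∈ T, A i v

/-- The commutator with a fixed operator. -/
def adE {M : Type*} [AddCommGroup M] [Module 𝕜 M] (a : Module.End 𝕜 M) :
    Module.End 𝕜 (Module.End 𝕜 M) :=
  LinearMap.mulLeft 𝕜 a - LinearMap.mulRight 𝕜 a

lemma adE_apply {M : Type*} [AddCommGroup M] [Module 𝕜 M] (a b : Module.End 𝕜 M) :
    adE a b = a * b - b * a := rfl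

namespace Setup
variable (h : Setup A v J S T)
include h

omit [DecidableEq V] in
lemma ne_of_mem {i : V} (hi : i ∈ J) : i ≠ v := fun e => h.notMem (e ▸ hi)

lemma isRep_L : IsRep A J T
    (fun i => if i = v then 0 else adE (op 𝕜 A (insert v J) S i)) (op 𝕜 A (insert v J) S v) where
  comm i j hij := by
    split_ifs <;> try simp
    ext1 y
    rw [Module.End.mul_apply, Module.End.mul_apply, ← sub_eq_zero]
    have e := sub_eq_zero.mpr ((isRep_op (𝕜 := 𝕜) (J := insert v J) (S := S)).comm i j hij)
    have : ∀ a b : Module.End 𝕜 (W 𝕜 A (insert v J) S), adE a (adE b y) - adE b (adE a y) =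
        (a * b - b * a) * y - y * (a * b - b * a) := fun a b => by
      simp only [adE_apply]; noncomm_ring
    rw [this, e]; simp
  zero i hi := by
    split_ifs with hv
    · rfl
    · rw [isRep_op.zero i (by simp [hv, hi])]
      ext1 y; simp [adE_apply]
  kill s hs := by
    rw [if_neg (h.ne_of_mem (h.subT hs)), adE_apply, isRep_op.comm _ _ (h.adj s hs), sub_self]

lemma isRep_inc : IsRep A J S
    (fun i => if i = v then 0 else op 𝕜 A (insert v J) S i) (one 𝕜 A (insert v J) S) where
  comm i j hij := by
    split_ifs <;> try simp
    exact isRep_op.comm i j hij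
  zero i hi := by
    split_ifs with hv
    · rfl
    · exact isRep_op.zero i (by simp [hv, hi])
  kill s hs := by
    rw [if_neg (h.ne_of_mem (h.subS hs)), isRep_op.kill s hs]

/-- Left multiplication by the element `⁅x₁, …⁅xₙ, x_v⁆…⁆` as a function of the word
`x₁ … xₙ`. -/
noncomputable def L : W 𝕜 A J T →ₗ[𝕜] Module.End 𝕜 (W 𝕜 A (insert v J) S) := lift h.isRep_L

/-- The inclusion of the submodule of words without `v`. -/
noncomputable def inc : W 𝕜 A J S →ₗ[𝕜] W 𝕜 A (insert v J) S := lift h.isRep_inc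

@[simp] lemma L_one : h.L (one 𝕜 A J T) = op 𝕜 A (insert v J) S v := lift_one _

@[simp] lemma inc_one : h.inc (one 𝕜 A J S) = one 𝕜 A (insert v J) S := lift_one _

lemma L_op {i : V} (hi : i ≠ v) (w : W 𝕜 A J T) :
    h.L (op 𝕜 A J T i w) = op 𝕜 A _ S i * h.L w - h.L w * op 𝕜 A _ S i := by
  rw [L, lift_op, if_neg hi, adE_apply]

lemma op_L {i : V} (hi : i ≠ v) (w : W 𝕜 A J T) (y) :
    op 𝕜 A _ S i (h.L w y) = h.L (op 𝕜 A J T i w) y + h.L w (op 𝕜 A _ S i y) := by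
  rw [h.L_op hi]; simp

lemma op_inc {i : V} (hi : i ≠ v) (w : W 𝕜 A J S) :
    op 𝕜 A (insert v J) S i (h.inc w) = h.inc (op 𝕜 A J S i w) := by
  rw [inc, lift_op, if_neg hi]

lemma L_mem_Wd {a : ℕ} {w : W 𝕜 A J T} (hw : w ∈ Wd 𝕜 A J T a) : ∀ {d : ℕ} {y},
    y ∈ Wd 𝕜 A (insert v J) S d → h.L w y ∈ Wd 𝕜 A (insert v J) S (a + 1 + d) := by
  induction hw using Submodule.span_induction with
  | mem w hl =>
    obtain ⟨l, rfl, rfl⟩ := hl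
    induction l with
    | nil =>
      intro d y hy
      have := op_mem_Wd v hy
      rw [add_comm] at this
      simpa [L_one] using this
    | cons i l ih =>
      intro d y hy
      by_cases hi : i = v
      · rw [wd_cons, isRep_op.zero i (hi ▸ h.notMem)]; simp
      · rw [wd_cons, h.L_op hi]
        refine sub_mem ?_ ?_
        · have := op_mem_Wd i (ih hy)
          rwa [show (i :: l).length + 1 + d = l.length + 1 + d + 1 by simp; omega]
        · have := ih (op_mem_Wd i hy)
          rwa [show (i :: l).length + 1 + d = l.length + 1 + (d + 1) by simp; omega]
  | zero => simp
  | add x z _ _ hx hz =>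
    intro d y hy
    rw [map_add]; exact add_mem (hx hy) (hz hy)
  | smul c x _ hx =>
    intro d y hy
    rw [map_smul]; exact Submodule.smul_mem _ _ (hx hy)

lemma inc_mem_Wd {d : ℕ} {w : W 𝕜 A J S} (hw : w ∈ Wd 𝕜 A J S d) :
    h.inc w ∈ Wd 𝕜 A (insert v J) S d := by
  induction hw using Submodule.span_induction with
  | mem w hl =>
    obtain ⟨l, rfl, rfl⟩ := hl
    induction l with
    | nil => simpa using one_mem_Wd
    | cons i l ih =>
      by_cases hi : i = v
      · rw [wd_cons, isRep_op.zero i (hi ▸ h.notMem)]; simp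
      · rw [wd_cons, ← h.op_inc hi]
        exact op_mem_Wd i ih
  | zero => simp
  | add x z _ _ hx hz => rw [map_add]; exact add_mem hx hz
  | smul c x _ hx => rw [map_smul]; exact Submodule.smul_mem _ _ hx

omit h in
variable (S) in
/-- Left multiplication in the model of words in a basis. -/
noncomputable def LP {β : Type*} (bas : Module.Basis β 𝕜 (W 𝕜 A J T)) :
    W 𝕜 A J T →ₗ[𝕜] Module.End 𝕜 (List β →₀ W 𝕜 A J S) :=
  bas.constr 𝕜 fun k => Finsupp.lmapDomain _ 𝕜 (List.cons k)

omit h [DecidableEq V] in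
lemma LP_bas {β : Type*} (bas : Module.Basis β 𝕜 (W 𝕜 A J T)) (k : β) (l : List β)
    (y : W 𝕜 A J S) : LP S bas (bas k) (Finsupp.single l y) = Finsupp.single (k :: l) y := by
  rw [LP, Module.Basis.constr_basis, Finsupp.lmapDomain_apply, Finsupp.mapDomain_single]

omit h in
variable (S) in
/-- The action of a generator on the model, on the words of a given shape. -/
noncomputable def Xaux {β : Type*} (bas : Module.Basis β 𝕜 (W 𝕜 A J T)) (i : V) :
    List β → (W 𝕜 A J S →ₗ[𝕜] (List β →₀ W 𝕜 A J S))
  | [] => (Finsupp.lsingle []).comp (op 𝕜 A J S i)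
  | k :: l => (LP S bas (op 𝕜 A J T i (bas k))).comp (Finsupp.lsingle l) +
      (LP S bas (bas k)).comp (Xaux bas i l)

omit h in
variable (S) in
/-- The action of a generator on the model. -/
noncomputable def Xm {β : Type*} (bas : Module.Basis β 𝕜 (W 𝕜 A J T)) (i : V) :
    Module.End 𝕜 (List β →₀ W 𝕜 A J S) := Finsupp.lsum 𝕜 (Xaux S bas i)

section model
omit h [DecidableEq V]
variable {β : Type*} (bas : Module.Basis β 𝕜 (W 𝕜 A J T))

lemma Xm_nil (i : V) (y : W 𝕜 A J S) :
    Xm S bas i (Finsupp.single [] y) = Finsupp.single [] (op 𝕜 A J S i y) := by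
  simp [Xm, Xaux]

lemma Xm_LP (i : V) (w : W 𝕜 A J T) :
    Xm S bas i * LP S bas w = LP S bas (op 𝕜 A J T i w) + LP S bas w * Xm S bas i := by
  have : (LinearMap.mulLeft 𝕜 (Xm S bas i)).comp (LP S bas) =
      (LP S bas).comp (op 𝕜 A J T i) + (LinearMap.mulRight 𝕜 (Xm S bas i)).comp (LP S bas) := by
    refine bas.ext fun k => ?_
    refine Finsupp.lhom_ext fun l y => ?_
    simp only [LinearMap.comp_apply, LinearMap.mulLeft_apply, LinearMap.mulRight_apply,
      LinearMap.add_apply, Module.End.mul_apply, LP_bas]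
    simp [Xm, Xaux]
  exact LinearMap.congr_fun this w

lemma Xm_LP_apply (i : V) (w : W 𝕜 A J T) (z) :
    Xm S bas i (LP S bas w z) = LP S bas (op 𝕜 A J T i w) z + LP S bas w (Xm S bas i z) :=
  LinearMap.congr_fun (Xm_LP bas i w) z

lemma Xm_comm (i j : V) (hij : A i j) : Xm S bas i * Xm S bas j = Xm S bas j * Xm S bas i := by
  refine Finsupp.lhom_ext fun l y => ?_
  have e : ∀ S (w : W 𝕜 A J S), op 𝕜 A J S i (op 𝕜 A J S j w) = op 𝕜 A J S j (op 𝕜 A J S i w) :=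
    fun S w => LinearMap.congr_fun (isRep_op.comm i j hij) w
  induction l with
  | nil => simp only [Module.End.mul_apply, Xm_nil, e]
  | cons k l ih =>
    replace ih : Xm S bas i (Xm S bas j (Finsupp.single l y)) =
      Xm S bas j (Xm S bas i (Finsupp.single l y)) := ih
    rw [← LP_bas bas]
    simp only [Module.End.mul_apply]
    simp only [Xm_LP_apply, map_add, e, ih]
    abel

lemma Xm_zero (i : V) (hi : i ∉ J) : Xm S bas i = 0 := by
  refine Finsupp.lhom_ext fun l y => ?_
  induction l with
  | nil => rw [Xm_nil, isRep_op.zero i hi]; simp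
  | cons k l ih => rw [← LP_bas bas, Xm_LP_apply, ih, isRep_op.zero i hi]; simp

end model

lemma isRep_model {β : Type*} (bas : Module.Basis β 𝕜 (W 𝕜 A J T)) : IsRep A (insert v J) S
    (fun i => if i = v then LP S bas (one 𝕜 A J T) else Xm S bas i)
    (Finsupp.single [] (one 𝕜 A J S)) := by
  have key : ∀ i, A i v →
      Xm S bas i * LP S bas (one 𝕜 A J T) = LP S bas (one 𝕜 A J T) * Xm S bas i := fun i hi => by
    by_cases hJ : i ∈ J
    · rw [Xm_LP, isRep_op.kill i (h.memT i hJ hi), map_zero, zero_add]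
    · rw [Xm_zero _ i hJ]; simp
  refine ⟨fun i j hij => ?_, fun i hi => ?_, fun s hs => ?_⟩
  · split_ifs with h1 h2 h2
    · rfl
    · exact (key j (h.symm _ _ (h1 ▸ hij))).symm
    · exact key i (h2 ▸ hij)
    · exact Xm_comm bas i j hij
  · rw [Finset.mem_insert, not_or] at hi
    rw [if_neg hi.1, Xm_zero _ _ hi.2]
  · rw [if_neg (h.ne_of_mem (h.subS hs)), Xm_nil, isRep_op.kill s hs, Finsupp.single_zero]

/-- The comparison with the model. -/
noncomputable def toModel {β : Type*} (bas : Module.Basis β 𝕜 (W 𝕜 A J T)) :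
    W 𝕜 A (insert v J) S →ₗ[𝕜] (List β →₀ W 𝕜 A J S) := lift (h.isRep_model bas)

lemma toModel_L {β : Type*} (bas : Module.Basis β 𝕜 (W 𝕜 A J T)) (w : W 𝕜 A J T) (y) :
    h.toModel bas (h.L w y) = LP S bas w (h.toModel bas y) := by
  have key : (LinearMap.compRight 𝕜 (h.toModel bas)).comp h.L =
      (LinearMap.lcomp 𝕜 _ (h.toModel bas)).comp (LP S bas) := by
    refine linearMap_ext ?_ fun i w hw => ?_
    · ext1 y
      simp [toModel]
    · ext1 y
      by_cases hi : i = v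
      · rw [isRep_op.zero i (hi ▸ h.notMem)]; simp
      · have h1 : ∀ y, h.toModel bas (h.L w y) = LP S bas w (h.toModel bas y) :=
          fun y => LinearMap.congr_fun hw y
        have h2 : ∀ y, h.toModel bas (op 𝕜 A (insert v J) S i y) = Xm S bas i (h.toModel bas y) :=
          fun y => by rw [toModel, lift_op, if_neg hi]
        change h.toModel bas (h.L (op 𝕜 A J T i w) y) = LP S bas (op 𝕜 A J T i w) (h.toModel bas y)
        rw [h.L_op hi, LinearMap.sub_apply, Module.End.mul_apply, Module.End.mul_apply, map_sub,
          h2, h1, h1, h2, Xm_LP_apply]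
        abel
  exact LinearMap.congr_fun (LinearMap.congr_fun key w) y

lemma toModel_inc {β : Type*} (bas : Module.Basis β 𝕜 (W 𝕜 A J T)) (y : W 𝕜 A J S) :
    h.toModel bas (h.inc y) = Finsupp.single [] y := by
  have key : (h.toModel bas).comp h.inc = Finsupp.lsingle [] := by
    refine linearMap_ext (by simp [toModel]) fun i w hw => ?_
    by_cases hi : i = v
    · rw [isRep_op.zero i (hi ▸ h.notMem)]; simp
    · have h2 : ∀ y, h.toModel bas (op 𝕜 A (insert v J) S i y) = Xm S bas i (h.toModel bas y) :=
        fun y => by rw [toModel, lift_op, if_neg hi]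
      simp only [LinearMap.comp_apply, Finsupp.lsingle_apply] at hw ⊢
      rw [← h.op_inc hi, h2, hw, Xm_nil]
  exact LinearMap.congr_fun key y

variable {Γ Γ' : Type*}

/-- The new basis elements. -/
noncomputable def fam (star : Γ) (c : Γ → W 𝕜 A J T) (c' : Γ' → W 𝕜 A J S)
    (x : List {γ // γ ≠ star} × Bool × Γ') : W 𝕜 A (insert v J) S :=
  x.1.foldr (fun (γ : {γ // γ ≠ star}) z => h.L (c γ) z)
    (if x.2.1 then op 𝕜 A _ S v (h.inc (c' x.2.2)) else h.inc (c' x.2.2))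

lemma linearIndependent_fam (star : Γ) (c : Γ → W 𝕜 A J T) (c' : Γ' → W 𝕜 A J S)
    (hc : LinearIndependent 𝕜 c) (hc' : LinearIndependent 𝕜 c') (hstar : c star = one 𝕜 A J T) :
    LinearIndependent 𝕜 (h.fam star c c') := by
  let bas := Module.Basis.sumExtend hc
  have hb : ∀ γ, bas (Sum.inl γ) = c γ := fun γ => sumExtend_inl hc γ
  let word : List {γ // γ ≠ star} × Bool × Γ' → List (Γ ⊕ Module.Basis.sumExtendIndex hc) :=
    fun x => x.1.map (fun γ => Sum.inl γ.1) ++ if x.2.1 then [Sum.inl star] else []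
  have key : ∀ x, h.toModel bas (h.fam star c c' x) = Finsupp.single (word x) (c' x.2.2) := by
    rintro ⟨l, ε, δ⟩
    induction l with
    | nil =>
      cases ε
      · simp [fam, word, toModel_inc]
      · simp only [fam, word, List.foldr_nil, if_true, List.map_nil, List.nil_append]
        rw [← h.L_one, toModel_L, toModel_inc, ← hstar, ← hb, LP_bas]
    | cons γ l ih =>
      have : h.fam star c c' (γ :: l, ε, δ) = h.L (c γ) (h.fam star c c' (l, ε, δ)) := rfl
      rw [this, toModel_L, ih, ← hb, LP_bas]
      rfl
  refine LinearIndependent.of_comp (h.toModel bas) ?_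
  have h1 := Finsupp.linearIndependent_single (R := 𝕜) (f := fun _ : List (Γ ⊕ Module.Basis.sumExtendIndex hc) => c')
    fun _ => hc'
  have h2 := h1.comp (fun x => (⟨word x, x.2.2⟩ : Σ _ : List (Γ ⊕ Module.Basis.sumExtendIndex hc), Γ')) (by
    rintro ⟨l1, e1, d1⟩ ⟨l2, e2, d2⟩ he
    simp only [Sigma.mk.injEq, heq_eq_eq] at he
    obtain ⟨hw, rfl⟩ := he
    have : l1 = l2 ∧ e1 = e2 := by
      clear key
      induction l1 generalizing l2 with
      | nil =>
        rcases l2 with _ | ⟨g, l2⟩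
        · revert hw; cases e1 <;> cases e2 <;> simp [word]
        · have := Ne.symm g.2
          revert hw; cases e1 <;> cases e2 <;> simp [word, this]
      | cons g1 l1 ih =>
        rcases l2 with _ | ⟨g, l2⟩
        · have := g1.2
          revert hw; cases e1 <;> cases e2 <;> simp [word, this]
        · simp only [word, List.map_cons, List.cons_append, List.cons.injEq, Sum.inl.injEq] at hw
          obtain ⟨rfl, rfl⟩ := ih l2 hw.2
          exact ⟨by rw [Subtype.ext hw.1], rfl⟩
    rw [this.1, this.2])
  convert h2 using 1
  funext x
  exact key x

end Setup
end PolyRep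

namespace PolyRep

section closure
variable {𝕜 : Type*} [Field 𝕜] {M : Type*} [AddCommGroup M] [Module 𝕜 M]

/-- The smallest subspace containing `s` and stable under the operators in `E`. -/
def cl (E : Set (Module.End 𝕜 M)) (s : Set M) : Submodule 𝕜 M :=
  sInf {U | s ⊆ U ∧ ∀ e ∈ E, ∀ x ∈ U, e x ∈ U}

lemma subset_cl (E : Set (Module.End 𝕜 M)) (s : Set M) : s ⊆ cl E s :=
  fun _ hx => Submodule.mem_sInf.mpr fun _ hU => hU.1 hx

lemma mem_cl {E : Set (Module.End 𝕜 M)} {s : Set M} {x : M} (hx : x ∈ s) : x ∈ cl E s :=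
  subset_cl E s hx

lemma cl_stable {E : Set (Module.End 𝕜 M)} {s : Set M} {e} (he : e ∈ E) {x} (hx : x ∈ cl E s) :
    e x ∈ cl E s :=
  Submodule.mem_sInf.mpr fun U hU => hU.2 e he x (Submodule.mem_sInf.mp hx U hU)

lemma cl_le {E : Set (Module.End 𝕜 M)} {s : Set M} {U : Submodule 𝕜 M} (hs : s ⊆ U)
    (hE : ∀ e ∈ E, ∀ x ∈ U, e x ∈ U) : cl E s ≤ U := sInf_le ⟨hs, hE⟩

/-- Induction for membership in a closure. -/
lemma cl_induction {E : Set (Module.End 𝕜 M)} {s : Set M} (U : Submodule 𝕜 M) (hs : s ⊆ U)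
    (hE : ∀ e ∈ E, ∀ x ∈ cl E s, x ∈ U → e x ∈ U) : cl E s ≤ U := by
  have : cl E s ≤ cl E s ⊓ U := cl_le (fun x hx => ⟨subset_cl E s hx, hs hx⟩)
    fun e he x hx => ⟨cl_stable he hx.1, hE e he x hx.1 hx.2⟩
  exact this.trans inf_le_right

end closure

section brk
variable {V R : Type*} [Ring R]

/-- Iterated commutators. -/
def brk (X : V → R) (l : List V) (b : V) : R := l.foldr (fun i z => X i * z - z * X i) (X b)

@[simp] lemma brk_nil (X : V → R) (b : V) : brk X [] b = X b := rfl
@[simp] lemma brk_cons (X : V → R) (i : V) (l : List V) (b : V) :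
    brk X (i :: l) b = X i * brk X l b - brk X l b * X i := rfl

lemma brk_mem_span {𝕜 : Type*} [CommRing 𝕜] [Algebra 𝕜 R] (X : V → R) (l : List V) (b : V) :
    brk X l b ∈ Submodule.span 𝕜 {z | ∃ t : List V, t.Perm (l ++ [b]) ∧ z = (t.map X).prod} := by
  induction l with
  | nil => exact Submodule.subset_span ⟨[b], List.Perm.refl _, by simp⟩
  | cons i l ih =>
    rw [brk_cons]
    generalize brk X l b = z at ih
    induction ih using Submodule.span_induction with
    | mem z hz =>
      obtain ⟨t, ht, rfl⟩ := hz
      refine sub_mem (Submodule.subset_span ⟨i :: t, ht.cons i, by simp⟩)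
        (Submodule.subset_span ⟨t ++ [i], ?_, by simp⟩)
      exact (List.perm_append_singleton i t).trans (ht.cons i)
    | zero => simp
    | add x y _ _ hx hy =>
      rw [mul_add, add_mul, add_sub_add_comm]
      exact add_mem hx hy
    | smul c x _ hx =>
      rw [mul_smul_comm, smul_mul_assoc, ← smul_sub]
      exact Submodule.smul_mem _ _ hx

end brk

variable {𝕜 : Type*} [Field 𝕜] {V : Type*} {A : V → V → Prop} {v : V} {J S T : Finset V}

/-- A word of distinct letters in `J`. -/
def Multilin (J : Finset V) (l : List V) : Prop := l.Nodup ∧ ∀ i ∈ l, i ∈ J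

lemma Multilin.perm {l l' : List V} (h : Multilin J l) (hp : l'.Perm l) : Multilin J l' :=
  ⟨hp.nodup_iff.mpr h.1, fun i hi => h.2 i (hp.mem_iff.mp hi)⟩

lemma Multilin.mono {J'} {l : List V} (h : Multilin J l) (hJ : J ⊆ J') : Multilin J' l :=
  ⟨h.1, fun i hi => hJ (h.2 i hi)⟩

lemma Multilin.of_append_right {s t : List V} (h : Multilin J (s ++ t)) : Multilin J t :=
  ⟨(List.nodup_append.mp h.1).2.1, fun i hi => h.2 i (List.mem_append_right _ hi)⟩

lemma Multilin.of_append_left {s t : List V} (h : Multilin J (s ++ t)) : Multilin J s :=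
  ⟨(List.nodup_append.mp h.1).1, fun i hi => h.2 i (List.mem_append_left _ hi)⟩

variable (𝕜 A J S) in
/-- The operators of the multilinear brackets. -/
def MB : Set (Module.End 𝕜 (W 𝕜 A J S)) :=
  {e | ∃ l b, l ≠ [] ∧ Multilin J (l ++ [b]) ∧ e = brk (op 𝕜 A J S) l b}

variable (𝕜 A J S) in
/-- The span of multilinear words under the action of multilinear brackets. -/
noncomputable def CC : Submodule 𝕜 (W 𝕜 A J S) := cl (MB 𝕜 A J S) {w | ∃ l, Multilin J l ∧ w = wd l}

variable (𝕜 A J S) in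
/-- The span of nonempty multilinear words under the action of multilinear brackets. -/
noncomputable def CP : Submodule 𝕜 (W 𝕜 A J S) := cl (MB 𝕜 A J S) {w | ∃ l, l ≠ [] ∧ Multilin J l ∧ w = wd l}

variable (𝕜 A J S) in
/-- The orbit of the cyclic vector under multilinear brackets. -/
noncomputable def BB : Submodule 𝕜 (W 𝕜 A J S) := cl (MB 𝕜 A J S) {one 𝕜 A J S}

lemma prod_map_op (t : List V) (w : W 𝕜 A J S) :
    (t.map (op 𝕜 A J S)).prod w = t.foldr (fun i w => op 𝕜 A J S i w) w := by
  induction t with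
  | nil => rfl
  | cons i t ih => rw [List.map_cons, List.prod_cons, Module.End.mul_apply, ih]; rfl

lemma foldr_op_brk_one_mem (s l : List V) (b : V) :
    s.foldr (fun i w => op 𝕜 A J S i w) (brk (op 𝕜 A J S) l b (one 𝕜 A J S)) ∈
      Submodule.span 𝕜 {w | ∃ t : List V, t.Perm (s ++ (l ++ [b])) ∧ w = wd t} := by
  rw [← prod_map_op]
  have := brk_mem_span (𝕜 := 𝕜) (op 𝕜 A J S) l b
  generalize brk (op 𝕜 A J S) l b = z at this
  induction this using Submodule.span_induction with
  | mem z hz =>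
    obtain ⟨t, ht, rfl⟩ := hz
    refine Submodule.subset_span ⟨s ++ t, ht.append_left s, ?_⟩
    rw [← Module.End.mul_apply, ← List.prod_append, ← List.map_append, prod_map_op]
    rfl
  | zero => simp
  | add x y _ _ hx hy =>
    rw [LinearMap.add_apply, map_add]
    exact add_mem hx hy
  | smul c x _ hx =>
    rw [LinearMap.smul_apply, map_smul]
    exact Submodule.smul_mem _ _ hx

lemma foldr_op_brk_one_mem_CP (s l : List V) (b : V) (h : Multilin J (s ++ (l ++ [b]))) :
    s.foldr (fun i w => op 𝕜 A J S i w) (brk (op 𝕜 A J S) l b (one 𝕜 A J S)) ∈ CP 𝕜 A J S := by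
  refine (Submodule.span_le.mpr ?_ :
    Submodule.span 𝕜 _ ≤ CP 𝕜 A J S) (foldr_op_brk_one_mem s l b)
  rintro _ ⟨t, ht, rfl⟩
  refine mem_cl ⟨t, ?_, h.perm ht, rfl⟩
  rintro rfl
  simpa using ht.length_eq

lemma brk_one_mem_CP (l : List V) (b : V) (h : Multilin J (l ++ [b])) :
    brk (op 𝕜 A J S) l b (one 𝕜 A J S) ∈ CP 𝕜 A J S :=
  foldr_op_brk_one_mem_CP [] l b h

lemma CP_le_CC : CP 𝕜 A J S ≤ CC 𝕜 A J S :=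
  cl_le (fun _ ⟨l, _, hl, hw⟩ => mem_cl ⟨l, hl, hw⟩) fun _ he _ hx => cl_stable he hx

lemma one_mem_BB : one 𝕜 A J S ∈ BB 𝕜 A J S := mem_cl rfl

lemma one_mem_CC : one 𝕜 A J S ∈ CC 𝕜 A J S :=
  mem_cl ⟨[], ⟨List.nodup_nil, by simp⟩, rfl⟩

lemma CC_le : CC 𝕜 A J S ≤ Submodule.span 𝕜 {one 𝕜 A J S} ⊔ CP 𝕜 A J S := by
  refine cl_le ?_ ?_
  · rintro _ ⟨l, hl, rfl⟩
    rcases l with _ | ⟨i, l⟩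
    · exact Submodule.mem_sup_left (Submodule.mem_span_singleton_self _)
    · exact Submodule.mem_sup_right (mem_cl ⟨i :: l, by simp, hl, rfl⟩)
  · rintro e he x hx
    obtain ⟨y, hy, z, hz, rfl⟩ := Submodule.mem_sup.mp hx
    obtain ⟨r, rfl⟩ := Submodule.mem_span_singleton.mp hy
    rw [map_add, map_smul]
    refine Submodule.mem_sup_right (add_mem (Submodule.smul_mem _ _ ?_) (cl_stable he hz))
    obtain ⟨l, b, _, hl, rfl⟩ := he
    exact brk_one_mem_CP l b hl

lemma aug_brk (l : List V) (b : V) (w : W 𝕜 A J S) : aug 𝕜 A J S (brk (op 𝕜 A J S) l b w) = 0 := by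
  induction l generalizing w with
  | nil => simp
  | cons i l ih => simp [ih]

lemma CP_le_ker : CP 𝕜 A J S ≤ LinearMap.ker (aug 𝕜 A J S) := by
  refine cl_le ?_ ?_
  · rintro _ ⟨l, hl, _, rfl⟩
    rcases l with _ | ⟨i, l⟩
    · exact absurd rfl hl
    · simp
  · rintro _ ⟨l, b, _, _, rfl⟩ x _
    exact aug_brk l b x

lemma Wd_le_ker {d : ℕ} (hd : 0 < d) : Wd 𝕜 A J S d ≤ LinearMap.ker (aug 𝕜 A J S) := by
  refine Submodule.span_le.mpr ?_
  rintro _ ⟨l, hl, rfl⟩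
  rcases l with _ | ⟨i, l⟩
  · simp at hl; omega
  · simp

lemma span_ne_star {Γ : Type*} {star : Γ} {c : Γ → W 𝕜 A J S} (hstar : c star = one 𝕜 A J S)
    (haug : ∀ γ, γ ≠ star → aug 𝕜 A J S (c γ) = 0)
    (hspan : Submodule.span 𝕜 (Set.range c) = CC 𝕜 A J S) :
    Submodule.span 𝕜 (Set.range fun γ : {γ // γ ≠ star} => c γ) = CP 𝕜 A J S := by
  apply le_antisymm
  · refine Submodule.span_le.mpr ?_
    rintro _ ⟨γ, rfl⟩
    have h1 : c γ ∈ CC 𝕜 A J S := hspan ▸ Submodule.subset_span ⟨γ, rfl⟩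
    obtain ⟨y, hy, z, hz, he⟩ := Submodule.mem_sup.mp (CC_le h1)
    obtain ⟨r, rfl⟩ := Submodule.mem_span_singleton.mp hy
    have h2 := congrArg (aug 𝕜 A J S) he
    rw [map_add, LinearMap.mem_ker.mp (CP_le_ker hz), haug _ γ.2] at h2
    have h3 : r = 0 := by simpa using h2
    rw [h3, zero_smul, zero_add] at he
    exact (he ▸ hz : c γ ∈ CP 𝕜 A J S)
  · intro x hx
    have h1 : x ∈ Submodule.span 𝕜 (Set.range c) := hspan ▸ CP_le_CC hx
    have h2 : Submodule.span 𝕜 (Set.range c) ≤ Submodule.span 𝕜 {one 𝕜 A J S} ⊔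
        Submodule.span 𝕜 (Set.range fun γ : {γ // γ ≠ star} => c γ) := by
      refine Submodule.span_le.mpr ?_
      rintro _ ⟨γ, rfl⟩
      by_cases h : γ = star
      · exact Submodule.mem_sup_left (h ▸ hstar ▸ Submodule.mem_span_singleton_self _)
      · exact Submodule.mem_sup_right (Submodule.subset_span ⟨⟨γ, h⟩, rfl⟩)
    obtain ⟨y, hy, z, hz, rfl⟩ := Submodule.mem_sup.mp (h2 h1)
    obtain ⟨r, rfl⟩ := Submodule.mem_span_singleton.mp hy
    have h3 : z ∈ LinearMap.ker (aug 𝕜 A J S) := by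
      refine (Submodule.span_le.mpr ?_ : Submodule.span 𝕜 _ ≤ _) hz
      rintro _ ⟨γ, rfl⟩
      exact haug _ γ.2
    have h4 := LinearMap.mem_ker.mp (CP_le_ker hx)
    rw [map_add, LinearMap.mem_ker.mp h3] at h4
    have h5 : r = 0 := by simpa using h4
    rwa [h5, zero_smul, zero_add]

end PolyRep

namespace PolyRep

variable {𝕜 : Type*} [Field 𝕜] {V : Type*} {A : V → V → Prop}
  {v : V} {J S T : Finset V}

lemma brk_mem_CC {l : List V} {b : V} (hne : l ≠ []) (hl : Multilin J (l ++ [b])) {y}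
    (hy : y ∈ CC 𝕜 A J S) : brk (op 𝕜 A J S) l b y ∈ CC 𝕜 A J S := by
  refine cl_stable (E := MB 𝕜 A J S) ?_ hy
  exact ⟨l, b, hne, hl, rfl⟩

lemma brk_mem_CP {l : List V} {b : V} (hne : l ≠ []) (hl : Multilin J (l ++ [b])) {y}
    (hy : y ∈ CP 𝕜 A J S) : brk (op 𝕜 A J S) l b y ∈ CP 𝕜 A J S := by
  refine cl_stable (E := MB 𝕜 A J S) ?_ hy
  exact ⟨l, b, hne, hl, rfl⟩

lemma brk_mem_BB {l : List V} {b : V} (hne : l ≠ []) (hl : Multilin J (l ++ [b])) {y}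
    (hy : y ∈ BB 𝕜 A J S) : brk (op 𝕜 A J S) l b y ∈ BB 𝕜 A J S := by
  refine cl_stable (E := MB 𝕜 A J S) ?_ hy
  exact ⟨l, b, hne, hl, rfl⟩

lemma wd_mem_CC {l : List V} (hl : Multilin J l) : (wd l : W 𝕜 A J S) ∈ CC 𝕜 A J S := by
  refine subset_cl _ _ ?_
  exact ⟨l, hl, rfl⟩

lemma wd_mem_CP {l : List V} (hne : l ≠ []) (hl : Multilin J l) :
    (wd l : W 𝕜 A J S) ∈ CP 𝕜 A J S := by
  refine subset_cl _ _ ?_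
  exact ⟨l, hne, hl, rfl⟩

variable [DecidableEq V]

namespace Setup
variable (h : Setup A v J S T)
include h

lemma brk_L {l : List V} (hl : v ∉ l) {b : V} (hb : b ≠ v) (w : W 𝕜 A J T) (y) :
    brk (op 𝕜 A (insert v J) S) l b (h.L w y) =
      h.L (brk (op 𝕜 A J T) l b w) y + h.L w (brk (op 𝕜 A (insert v J) S) l b y) := by
  induction l generalizing w y with
  | nil => exact h.op_L hb w y
  | cons i l ih =>
    rw [List.mem_cons, not_or] at hl
    have hi := Ne.symm hl.1
    replace ih := ih hl.2
    simp only [brk_cons, LinearMap.sub_apply, Module.End.mul_apply, ih, h.op_L hi, map_add,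
      map_sub]
    abel

lemma brk_inc {l : List V} (hl : v ∉ l) {b : V} (hb : b ≠ v) (y : W 𝕜 A J S) :
    brk (op 𝕜 A (insert v J) S) l b (h.inc y) = h.inc (brk (op 𝕜 A J S) l b y) := by
  induction l generalizing y with
  | nil => exact h.op_inc hb y
  | cons i l ih =>
    rw [List.mem_cons, not_or] at hl
    have hi := Ne.symm hl.1
    replace ih := ih hl.2
    simp only [brk_cons, LinearMap.sub_apply, Module.End.mul_apply, ih, h.op_inc hi, map_sub]

lemma brk_eq_L {l : List V} (hl : v ∉ l) :
    brk (op 𝕜 A (insert v J) S) l v = h.L (wd l : W 𝕜 A J T) := by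
  induction l with
  | nil => simp
  | cons i l ih =>
    rw [List.mem_cons, not_or] at hl
    rw [brk_cons, ih hl.2, wd_cons, h.L_op (Ne.symm hl.1)]

lemma brk_append_eq_L {s s' : List V} (hs : v ∉ s) (hs' : v ∉ s') {b : V} (hb : b ≠ v) :
    brk (op 𝕜 A (insert v J) S) (s ++ v :: s') b =
      -h.L (s.foldr (fun i w => op 𝕜 A J T i w) (brk (op 𝕜 A J T) s' b (one 𝕜 A J T))) := by
  induction s with
  | nil =>
    ext1 y
    have := h.brk_L hs' hb (one 𝕜 A J T) y
    simp only [L_one] at this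
    simp [this]
  | cons i s ih =>
    rw [List.mem_cons, not_or] at hs
    rw [List.cons_append, brk_cons, ih hs.2, List.foldr_cons, h.L_op (Ne.symm hs.1)]
    noncomm_ring

lemma wd_eq_inc {l : List V} (hl : v ∉ l) : wd l = h.inc (wd l : W 𝕜 A J S) := by
  induction l with
  | nil => simp
  | cons i l ih =>
    rw [List.mem_cons, not_or] at hl
    rw [wd_cons, ih hl.2, wd_cons, h.op_inc (Ne.symm hl.1)]

lemma wd_append_mem (s s' : List V) (hs : v ∉ s) (hs' : v ∉ s') :
    (wd (s ++ v :: s') : W 𝕜 A (insert v J) S) ∈ Submodule.span 𝕜 {z | ∃ t t' : List V,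
      (t ++ t').Perm (s ++ s') ∧ z = h.L (wd t) (h.inc (wd t'))} := by
  induction s with
  | nil => exact Submodule.subset_span ⟨[], s', List.Perm.refl _, by simp [h.wd_eq_inc hs']⟩
  | cons i s ih =>
    rw [List.mem_cons, not_or] at hs
    have hi := Ne.symm hs.1
    replace ih := ih hs.2
    rw [show i :: s ++ v :: s' = i :: (s ++ v :: s') from rfl, wd_cons]
    generalize (wd (s ++ v :: s') : W 𝕜 A (insert v J) S) = z at ih
    induction ih using Submodule.span_induction with
    | mem z hz =>
      obtain ⟨t, t', ht, rfl⟩ := hz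
      rw [h.op_L hi, h.op_inc hi]
      refine add_mem (Submodule.subset_span ⟨i :: t, t', ht.cons i, rfl⟩)
        (Submodule.subset_span ⟨t, i :: t', ?_, rfl⟩)
      exact List.perm_middle.trans (ht.cons i)
    | zero => simp
    | add x y _ _ hx hy => rw [map_add]; exact add_mem hx hy
    | smul c x _ hx => rw [map_smul]; exact Submodule.smul_mem _ _ hx

omit h in
lemma Multilin_of_insert {l : List V} (hl : Multilin (insert v J) l) (hv : v ∉ l) :
    Multilin J l :=
  ⟨hl.1, fun i hi => Finset.mem_of_mem_insert_of_ne (hl.2 i hi) fun e => hv (e ▸ hi)⟩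

omit h in
lemma Multilin_middle {s s' : List V} (hl : Multilin (insert v J) (s ++ v :: s')) :
    v ∉ s ∧ v ∉ s' ∧ Multilin J (s ++ s') := by
  have h1 : Multilin (insert v J) (v :: (s ++ s')) := hl.perm List.perm_middle.symm
  have h2 := List.nodup_cons.mp h1.1
  rw [List.mem_append, not_or] at h2
  refine ⟨h2.1.1, h2.1.2, Multilin_of_insert ⟨h2.2, fun i hi => h1.2 i (List.mem_cons_of_mem _ hi)⟩ ?_⟩
  simpa using h2.1

/-- The operators `L w`, for `w` of positive degree. -/
def EL : Set (Module.End 𝕜 (W 𝕜 A (insert v J) S)) := {e | ∃ w ∈ CP 𝕜 A J T, e = h.L w}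

lemma L_mem_cl {s : Set (W 𝕜 A (insert v J) S)} {w} (hw : w ∈ CP 𝕜 A J T) {x}
    (hx : x ∈ cl h.EL s) : h.L w x ∈ cl h.EL s := by
  refine cl_stable (E := h.EL) ?_ hx
  exact ⟨w, hw, rfl⟩

/-- A bracket containing the letter `v` acts as some `L w`. -/
lemma brk_mem (e) (he : e ∈ MB 𝕜 A (insert v J) S) :
    (∃ l b, l ≠ [] ∧ v ∉ l ∧ b ≠ v ∧ Multilin J (l ++ [b]) ∧
      e = brk (op 𝕜 A (insert v J) S) l b) ∨ e ∈ h.EL (𝕜 := 𝕜) := by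
  obtain ⟨l, b, hne, hl, rfl⟩ := he
  by_cases hb : b = v
  · subst hb
    obtain ⟨h1, -, h2⟩ := Multilin_middle hl
    right
    exact ⟨wd l, mem_cl ⟨l, hne, by simpa using h2, rfl⟩, h.brk_eq_L h1⟩
  by_cases hv : v ∈ l
  · obtain ⟨s, s', rfl⟩ := List.append_of_mem hv
    have hl' : Multilin (insert v J) (s ++ v :: (s' ++ [b])) := by simpa using hl
    obtain ⟨h1, h2, h3⟩ := Multilin_middle hl'
    rw [List.mem_append, not_or] at h2
    right
    refine ⟨_, neg_mem (foldr_op_brk_one_mem_CP s s' b h3), ?_⟩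
    rw [h.brk_append_eq_L h1 h2.1 hb, map_neg]
  · left
    refine ⟨l, b, hne, hv, hb, Multilin_of_insert hl ?_, rfl⟩
    simp [hv, Ne.symm hb]

omit h in
lemma brk_mem_MB {l : List V} {b : V} (hne : l ≠ []) (hl : Multilin J (l ++ [b])) :
    brk (op 𝕜 A (insert v J) S) l b ∈ MB 𝕜 A (insert v J) S :=
  ⟨l, b, hne, hl.mono (Finset.subset_insert _ _), rfl⟩

omit [DecidableEq V] in
lemma notMem_of_Multilin {l : List V} (hl : Multilin J l) : v ∉ l := fun hv => h.notMem (hl.2 v hv)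

/-- A subspace stable under the brackets is stable under the operators `L w`. -/
lemma L_stable (U : Submodule 𝕜 (W 𝕜 A (insert v J) S))
    (hU : ∀ e ∈ MB 𝕜 A (insert v J) S, ∀ x ∈ U, e x ∈ U) {w} (hw : w ∈ CP 𝕜 A J T) :
    ∀ x ∈ U, h.L w x ∈ U := by
  let D : Submodule 𝕜 (W 𝕜 A J T) :=
    { carrier := {w | ∀ x ∈ U, h.L w x ∈ U}
      add_mem' := fun ha hb x hx => by rw [map_add]; exact add_mem (ha x hx) (hb x hx)
      zero_mem' := fun x _ => by simp
      smul_mem' := fun c a ha x hx => by rw [map_smul]; exact U.smul_mem c (ha x hx) }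
  refine (cl_le (U := D) ?_ ?_ : CP 𝕜 A J T ≤ D) hw
  · rintro _ ⟨l, hne, hl, rfl⟩ x hx
    rw [← h.brk_eq_L (h.notMem_of_Multilin hl)]
    refine hU _ ⟨l, v, hne, ?_, rfl⟩ x hx
    refine Multilin.perm ?_ (List.perm_append_singleton v l)
    exact ⟨List.nodup_cons.mpr ⟨h.notMem_of_Multilin hl, hl.1⟩, by
      intro i hi
      rcases List.mem_cons.mp hi with rfl | hi
      · simp
      · simp [hl.2 i hi]⟩
  · rintro _ ⟨l, b, hne, hl, rfl⟩ w hw x hx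
    have hv := h.notMem_of_Multilin hl
    rw [List.mem_append, not_or] at hv
    have hb : b ≠ v := fun e => hv.2 (by simp [e])
    have e1 := h.brk_L hv.1 hb w x (𝕜 := 𝕜)
    rw [← sub_eq_iff_eq_add] at e1
    rw [← e1]
    have h1 : brk (op 𝕜 A (insert v J) S) l b ∈ MB 𝕜 A (insert v J) S := brk_mem_MB hne hl
    exact sub_mem (hU _ h1 _ (hw x hx)) (hw _ (hU _ h1 _ hx))

/-- A closure under the operators `L w` is stable under brackets, if the generators are. -/
lemma MB_stable (s : Set (W 𝕜 A (insert v J) S))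
    (hs : ∀ l b, l ≠ [] → v ∉ l → b ≠ v → Multilin J (l ++ [b]) → ∀ x ∈ s,
      brk (op 𝕜 A (insert v J) S) l b x ∈ cl h.EL s) :
    ∀ e ∈ MB 𝕜 A (insert v J) S, ∀ x ∈ cl h.EL s, e x ∈ cl h.EL s := by
  intro e he
  rcases h.brk_mem e he with ⟨l, b, hne, hv, hb, hl, rfl⟩ | he
  · refine cl_induction ((cl h.EL s).comap (brk (op 𝕜 A (insert v J) S) l b))
      (hs l b hne hv hb hl) ?_
    rintro _ ⟨w, hw, rfl⟩ x hx hxe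
    rw [Submodule.mem_comap, h.brk_L hv hb]
    exact add_mem (h.L_mem_cl (brk_mem_CP hne hl hw) hx) (h.L_mem_cl hw hxe)
  · exact fun x hx => cl_stable he hx

lemma BB_insert : BB 𝕜 A (insert v J) S = cl h.EL (h.inc '' (BB 𝕜 A J S : Set _)) := by
  apply le_antisymm
  · refine cl_le ?_ (h.MB_stable _ ?_)
    · rintro _ rfl
      exact subset_cl _ _ ⟨_, one_mem_BB, h.inc_one⟩
    · rintro l b hne hv hb hl _ ⟨y, hy, rfl⟩
      rw [h.brk_inc hv hb]
      exact subset_cl _ _ ⟨_, brk_mem_BB hne hl hy, rfl⟩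
  · have key : BB 𝕜 A J S ≤ (BB 𝕜 A (insert v J) S).comap h.inc := by
      refine cl_le ?_ ?_
      · intro x hx
        rw [Set.mem_singleton_iff.mp hx, SetLike.mem_coe, Submodule.mem_comap, h.inc_one]
        exact one_mem_BB
      · rintro _ ⟨l, b, hne, hl, rfl⟩ y hy
        have hv := h.notMem_of_Multilin hl
        rw [List.mem_append, not_or] at hv
        rw [Submodule.mem_comap, ← h.brk_inc hv.1 (fun e => hv.2 (by simp [e]))]
        exact brk_mem_BB hne (hl.mono (Finset.subset_insert _ _)) hy
    refine cl_le ?_ ?_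
    · rintro _ ⟨y, hy, rfl⟩
      exact key hy
    · rintro _ ⟨w, hw, rfl⟩
      exact h.L_stable _ (fun e he x hx => cl_stable he hx) hw

lemma CC_insert : CC 𝕜 A (insert v J) S = cl h.EL (h.inc '' (CC 𝕜 A J S : Set _) ∪
    (fun y => op 𝕜 A _ S v (h.inc y)) '' (CC 𝕜 A J S : Set _)) := by
  apply le_antisymm
  · refine cl_le ?_ (h.MB_stable _ ?_)
    · rintro _ ⟨l, hl, rfl⟩
      by_cases hv : v ∈ l
      · obtain ⟨s, s', rfl⟩ := List.append_of_mem hv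
        obtain ⟨h1, h2, h3⟩ := Multilin_middle hl
        refine (Submodule.span_le.mpr ?_ : Submodule.span 𝕜 _ ≤ _) (h.wd_append_mem s s' h1 h2)
        rintro _ ⟨t, t', ht, rfl⟩
        have h4 := h3.perm ht
        have h5 : (wd t' : W 𝕜 A J S) ∈ CC 𝕜 A J S :=
          wd_mem_CC h4.of_append_right
        by_cases h6 : t = []
        · subst h6
          exact subset_cl _ _ (Or.inr ⟨_, h5, by simp⟩)
        · exact h.L_mem_cl (wd_mem_CP h6 h4.of_append_left)
            (subset_cl _ _ (Or.inl ⟨_, h5, rfl⟩))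
      · exact subset_cl _ _ (Or.inl
          ⟨_, wd_mem_CC (Multilin_of_insert hl hv), (h.wd_eq_inc hv).symm⟩)
    · rintro l b hne hv hb hl _ (⟨y, hy, rfl⟩ | ⟨y, hy, rfl⟩)
      · rw [h.brk_inc hv hb]
        exact subset_cl _ _ (Or.inl ⟨_, brk_mem_CC hne hl hy, rfl⟩)
      · dsimp only
        rw [← h.L_one, h.brk_L hv hb, h.brk_inc hv hb, h.L_one]
        exact add_mem (h.L_mem_cl (brk_one_mem_CP l b hl)
          (subset_cl _ _ (Or.inl ⟨_, hy, rfl⟩)))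
          (subset_cl _ _ (Or.inr ⟨_, brk_mem_CC hne hl hy, rfl⟩))
  · have hst : ∀ e ∈ MB 𝕜 A (insert v J) S, ∀ x ∈ CC 𝕜 A (insert v J) S,
      e x ∈ CC 𝕜 A (insert v J) S := fun e he x hx => cl_stable he hx
    refine cl_le ?_ ?_
    · have key : CC 𝕜 A J S ≤ (CC 𝕜 A (insert v J) S).comap h.inc ⊓
          (CC 𝕜 A (insert v J) S).comap ((op 𝕜 A _ S v).comp h.inc) := by
        refine cl_le ?_ ?_
        · rintro _ ⟨l, hl, rfl⟩
          have hv := h.notMem_of_Multilin hl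
          refine ⟨?_, ?_⟩
          · change h.inc (wd l : W 𝕜 A J S) ∈ CC 𝕜 A (insert v J) S
            rw [← h.wd_eq_inc hv]
            exact wd_mem_CC (hl.mono (Finset.subset_insert _ _))
          · change op 𝕜 A (insert v J) S v (h.inc (wd l : W 𝕜 A J S)) ∈ CC 𝕜 A (insert v J) S
            rw [← h.wd_eq_inc hv, ← wd_cons]
            refine wd_mem_CC ⟨List.nodup_cons.mpr ⟨hv, hl.1⟩, ?_⟩
            intro i hi
            rcases List.mem_cons.mp hi with rfl | hi
            · simp
            · simp [hl.2 i hi]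
        · rintro _ ⟨l, b, hne, hl, rfl⟩ y ⟨hy1, hy2⟩
          have hv := h.notMem_of_Multilin hl
          rw [List.mem_append, not_or] at hv
          have hb : b ≠ v := fun e => hv.2 (by simp [e])
          have hm : brk (op 𝕜 A (insert v J) S) l b ∈ MB 𝕜 A (insert v J) S := brk_mem_MB hne hl
          replace hy1 : h.inc y ∈ CC 𝕜 A (insert v J) S := hy1
          replace hy2 : op 𝕜 A (insert v J) S v (h.inc y) ∈ CC 𝕜 A (insert v J) S := hy2
          refine ⟨?_, ?_⟩
          · rw [SetLike.mem_coe, Submodule.mem_comap, ← h.brk_inc hv.1 hb]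
            exact hst _ hm _ hy1
          · rw [SetLike.mem_coe, Submodule.mem_comap, LinearMap.comp_apply, ← h.brk_inc hv.1 hb]
            have e1 := h.brk_L hv.1 hb (one 𝕜 A J T) (h.inc y)
            rw [h.L_one, ← sub_eq_iff_eq_add'] at e1
            rw [← e1]
            exact sub_mem (hst _ hm _ hy2) (h.L_stable _ hst (brk_one_mem_CP l b hl) _ hy1)
      rintro _ (⟨y, hy, rfl⟩ | ⟨y, hy, rfl⟩)
      · exact (key hy).1
      · exact (key hy).2
    · rintro _ ⟨w, hw, rfl⟩
      exact h.L_stable _ hst hw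

section span
variable {Γ Γ' : Type*} {star : Γ} {c : Γ → W 𝕜 A J T} {c' : Γ' → W 𝕜 A J S}
  (hspan : Submodule.span 𝕜 (Set.range fun γ : {γ // γ ≠ star} => c γ) = CP 𝕜 A J T)
include hspan

/-- Words in the operators `L (c γ)` span a closure under the operators `L w`. -/
lemma span_foldr {δ : Type*} (g : δ → W 𝕜 A (insert v J) S) (s : Set (W 𝕜 A (insert v J) S))
    (hs : s ⊆ Submodule.span 𝕜 (Set.range g)) (hs' : ∀ x, g x ∈ cl h.EL s) :
    Submodule.span 𝕜 (Set.range fun x : List {γ // γ ≠ star} × δ =>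
      x.1.foldr (fun (γ : {γ // γ ≠ star}) z => h.L (c γ) z) (g x.2)) = cl h.EL s := by
  apply le_antisymm
  · refine Submodule.span_le.mpr ?_
    rintro _ ⟨⟨l, x⟩, rfl⟩
    induction l with
    | nil => exact hs' x
    | cons γ l ih => exact h.L_mem_cl (hspan ▸ Submodule.subset_span ⟨γ, rfl⟩) ih
  · refine cl_le (fun x hx => ?_) ?_
    · refine (Submodule.span_le.mpr ?_ : Submodule.span 𝕜 (Set.range g) ≤ _) (hs hx)
      rintro _ ⟨x, rfl⟩
      exact Submodule.subset_span ⟨([], x), rfl⟩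
    · rintro _ ⟨w, hw, rfl⟩ x hx
      rw [← hspan] at hw
      induction hw using Submodule.span_induction with
      | mem w hw =>
        obtain ⟨γ, rfl⟩ := hw
        induction hx using Submodule.span_induction with
        | mem x hx =>
          obtain ⟨⟨l, y⟩, rfl⟩ := hx
          exact Submodule.subset_span ⟨(γ :: l, y), rfl⟩
        | zero => simp
        | add x y _ _ hx hy => rw [map_add]; exact add_mem hx hy
        | smul c x _ hx => rw [map_smul]; exact Submodule.smul_mem _ _ hx
      | zero => simp
      | add x y _ _ hx hy => rw [map_add]; exact add_mem hx hy
      | smul c x _ hx => rw [map_smul]; exact Submodule.smul_mem _ _ hx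

lemma span_fam (hc' : Submodule.span 𝕜 (Set.range c') = CC 𝕜 A J S) :
    Submodule.span 𝕜 (Set.range (h.fam star c c')) = CC 𝕜 A (insert v J) S := by
  have hm : ∀ δ, c' δ ∈ CC 𝕜 A J S := fun δ => hc' ▸ Submodule.subset_span ⟨δ, rfl⟩
  rw [h.CC_insert]
  refine h.span_foldr hspan
    (fun x : Bool × Γ' => if x.1 then op 𝕜 A _ S v (h.inc (c' x.2)) else h.inc (c' x.2)) _ ?_ ?_
  · rintro _ (⟨y, hy, rfl⟩ | ⟨y, hy, rfl⟩)
    · have : Submodule.span 𝕜 (Set.range c') ≤ (Submodule.span 𝕜 (Set.range fun x : Bool × Γ' =>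
        if x.1 then op 𝕜 A _ S v (h.inc (c' x.2)) else h.inc (c' x.2))).comap h.inc := by
        refine Submodule.span_le.mpr ?_
        rintro _ ⟨δ, rfl⟩
        exact Submodule.subset_span ⟨(false, δ), by simp⟩
      exact this (hc' ▸ hy)
    · have : Submodule.span 𝕜 (Set.range c') ≤ (Submodule.span 𝕜 (Set.range fun x : Bool × Γ' =>
        if x.1 then op 𝕜 A _ S v (h.inc (c' x.2)) else h.inc (c' x.2))).comap
          ((op 𝕜 A _ S v).comp h.inc) := by
        refine Submodule.span_le.mpr ?_
        rintro _ ⟨δ, rfl⟩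
        exact Submodule.subset_span ⟨(true, δ), by simp⟩
      exact this (hc' ▸ hy)
  · rintro ⟨_ | _, δ⟩
    · exact subset_cl _ _ (Or.inl ⟨_, hm δ, by simp⟩)
    · exact subset_cl _ _ (Or.inr ⟨_, hm δ, by simp⟩)

lemma span_fam_false (hc' : Submodule.span 𝕜 (Set.range c') = BB 𝕜 A J S) :
    Submodule.span 𝕜 (Set.range fun x : List {γ // γ ≠ star} × Γ' =>
      h.fam star c c' (x.1, false, x.2)) = BB 𝕜 A (insert v J) S := by
  rw [h.BB_insert]
  refine h.span_foldr hspan (fun x => h.inc (c' x)) _ ?_ fun x =>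
    subset_cl _ _ ⟨_, hc' ▸ Submodule.subset_span ⟨x, rfl⟩, rfl⟩
  rintro _ ⟨y, hy, rfl⟩
  have : Submodule.span 𝕜 (Set.range c') ≤
      (Submodule.span 𝕜 (Set.range fun x => h.inc (c' x))).comap h.inc := by
    refine Submodule.span_le.mpr ?_
    rintro _ ⟨δ, rfl⟩
    exact Submodule.subset_span ⟨δ, rfl⟩
  exact this (hc' ▸ hy)

end span

lemma fam_mem_Wd {Γ Γ' : Type*} (star : Γ) {c : Γ → W 𝕜 A J T} {c' : Γ' → W 𝕜 A J S}
    {deg : Γ → ℕ} {deg' : Γ' → ℕ} (hc : ∀ γ, c γ ∈ Wd 𝕜 A J T (deg γ))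
    (hc' : ∀ γ, c' γ ∈ Wd 𝕜 A J S (deg' γ)) (x : List {γ // γ ≠ star} × Bool × Γ') :
    h.fam star c c' x ∈ Wd 𝕜 A (insert v J) S
      (GradedCount.listDeg (fun γ : {γ // γ ≠ star} => deg γ + 1) x.1 +
        (x.2.1.toNat + deg' x.2.2)) := by
  obtain ⟨l, ε, δ⟩ := x
  induction l with
  | nil =>
    have h1 := h.inc_mem_Wd (hc' δ)
    cases ε
    · simpa [fam, GradedCount.listDeg] using h1
    · have h2 := op_mem_Wd v h1
      rw [add_comm] at h2
      simpa [fam, GradedCount.listDeg] using h2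
  | cons γ l ih =>
    have := h.L_mem_Wd (hc γ) ih
    simp only [GradedCount.listDeg, List.map_cons, List.sum_cons] at this ⊢
    rw [add_assoc (deg γ + 1)]
    exact this

end Setup
end PolyRep

namespace PolyRep

section links
variable {V : Type*} [DecidableEq V] {R : Type*} [CommRing R]

/-- The face polynomial of the full subcomplex on `J`. -/
def facePoly (K : Finset (Finset V)) (y : R) (J : Finset V) : R := ∑ I ∈ K with I ⊆ J, y ^ I.card

lemma facePoly_insert (K : Finset (Finset V)) (hK : ∀ I ∈ K, ∀ I' ⊆ I, I' ∈ K)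
    (hflag : ∀ S : Finset V, (∀ i ∈ S, ∀ j ∈ S, i ≠ j → {i, j} ∈ K) → S ∈ K) (y : R) {v : V}
    {J : Finset V} (hv : v ∉ J) :
    facePoly K y (insert v J) = facePoly K y J + y * facePoly K y {i ∈ J | {i, v} ∈ K} := by
  rw [facePoly, ← Finset.sum_filter_add_sum_filter_not _ (fun I => v ∉ I)]
  congr 1
  · refine Finset.sum_congr ?_ fun _ _ => rfl
    ext I
    simp only [Finset.mem_filter, and_assoc, and_congr_right_iff]
    intro _
    constructor
    · rintro ⟨h1, h2⟩
      exact (Finset.subset_insert_iff_of_notMem h2).mp h1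
    · exact fun h => ⟨h.trans (Finset.subset_insert _ _), fun h' => hv (h h')⟩
  · rw [facePoly, Finset.mul_sum]
    refine Finset.sum_nbij' (fun I => I.erase v) (fun I => insert v I) ?_ ?_ ?_ ?_ ?_
    · intro I hI
      simp only [Finset.mem_filter, not_not] at hI ⊢
      obtain ⟨⟨h1, h2⟩, h3⟩ := hI
      refine ⟨hK _ h1 _ (Finset.erase_subset _ _), fun i hi => ?_⟩
      rw [Finset.mem_erase] at hi
      refine Finset.mem_filter.mpr ⟨Finset.mem_of_mem_insert_of_ne (h2 hi.2) hi.1, hK _ h1 _ ?_⟩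
      intro j hj
      simp only [Finset.mem_insert, Finset.mem_singleton] at hj
      rcases hj with rfl | rfl
      exacts [hi.2, h3]
    · intro I hI
      simp only [Finset.mem_filter, not_not] at hI ⊢
      obtain ⟨h1, h2⟩ := hI
      refine ⟨⟨hflag _ fun i hi j hj hij => ?_, Finset.insert_subset_insert _
        fun i hi => (Finset.mem_filter.mp (h2 hi)).1⟩, Finset.mem_insert_self _ _⟩
      rcases Finset.mem_insert.mp hi with rfl | hi'
      · rcases Finset.mem_insert.mp hj with rfl | hj'
        · exact absurd rfl hij
        · rw [Finset.pair_comm]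
          exact (Finset.mem_filter.mp (h2 hj')).2
      · rcases Finset.mem_insert.mp hj with rfl | hj'
        · exact (Finset.mem_filter.mp (h2 hi')).2
        · exact hK _ h1 _ (by simp [Finset.insert_subset_iff, hi', hj'])
    · intro I hI
      exact Finset.insert_erase (by simpa using (Finset.mem_filter.mp hI).2)
    · intro I hI
      refine Finset.erase_insert fun h => hv ?_
      exact (Finset.mem_filter.mp ((Finset.mem_filter.mp hI).2 h)).1
    · intro I hI
      rw [← pow_succ', Finset.card_erase_add_one (by simpa using (Finset.mem_filter.mp hI).2)]

/-- Adjacency of vertices of a simplicial complex. -/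
def adj (K : Finset (Finset V)) (i j : V) : Prop := {i, j} ∈ K

/-- Adding a vertex to a full subcomplex. -/
lemma setup_link (K : Finset (Finset V)) {v : V} {J S : Finset V} (hv : v ∉ J) (hS : S ⊆ J) :
    Setup (adj K) v J S {i ∈ J | {i, v} ∈ K} where
  symm i j hij := by rwa [adj, Finset.pair_comm]
  notMem := hv
  subS := hS
  subT := Finset.filter_subset _ _
  memT i hi hiv := Finset.mem_filter.mpr ⟨hi, hiv⟩
  adj i hi := (Finset.mem_filter.mp hi).2

end links

variable {𝕜 : Type*} [Field 𝕜] {V : Type*} {A : V → V → Prop} {J S : Finset V}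

lemma one_ne_zero' : one 𝕜 A J S ≠ 0 := fun h => by
  simpa [h] using aug_one (𝕜 := 𝕜) (A := A) (J := J) (S := S)

lemma CP_self : CP 𝕜 A J J ≤ ⊥ := by
  have h : ∀ l : List V, l ≠ [] → (wd l : W 𝕜 A J J) = 0 := by
    intro l hl
    induction l with
    | nil => exact absurd rfl hl
    | cons i l ih =>
      rw [wd_cons]
      rcases l with _ | ⟨j, l⟩
      · by_cases hi : i ∈ J
        · exact isRep_op.kill i hi
        · rw [isRep_op.zero i hi]; rfl
      · rw [ih (by simp), map_zero]
  refine cl_le ?_ ?_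
  · rintro _ ⟨l, hl, _, rfl⟩
    exact h l hl
  · rintro e _ x hx
    rw [(Submodule.mem_bot 𝕜).mp hx, map_zero]
    exact zero_mem _

lemma CC_self : CC 𝕜 A J J = Submodule.span 𝕜 {one 𝕜 A J J} := by
  apply le_antisymm
  · exact CC_le.trans (sup_le le_rfl (CP_self.trans bot_le))
  · exact (Submodule.span_singleton_le_iff_mem _ _).mpr one_mem_CC

lemma BB_le_CC : BB 𝕜 A J S ≤ CC 𝕜 A J S :=
  cl_le (fun _ hx => Set.mem_singleton_iff.mp hx ▸ one_mem_CC) fun _ he _ hx => cl_stable he hx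

section counting
open GradedCount PowerSeries
variable [DecidableEq V] (K : Finset (Finset V))

/-- A homogeneous basis of a subspace of `W` with its degrees. -/
structure HomBasis (𝕜 : Type*) [Field 𝕜] (A : V → V → Prop) (J S : Finset V)
    (U : Submodule 𝕜 (W 𝕜 A J S)) {Γ : Type} (deg : Γ → ℕ) (c : Γ → W 𝕜 A J S) : Prop where
  li : LinearIndependent 𝕜 c
  span : Submodule.span 𝕜 (Set.range c) = U
  homog : ∀ γ, c γ ∈ Wd 𝕜 A J S (deg γ)
  fin : FinFib deg

namespace Setup
variable {v : V} {T : Finset V} (h : Setup A v J S T) {Γ Γ' : Type} {star : Γ} {deg : Γ → ℕ}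
  {deg' : Γ' → ℕ} {c : Γ → W 𝕜 A J T} {c' : Γ' → W 𝕜 A J S}
  (hb : HomBasis 𝕜 A J T (CC 𝕜 A J T) deg c) (hstar : c star = one 𝕜 A J T)
  (hdeg : deg star = 0) (hpos : ∀ γ, γ ≠ star → 0 < deg γ)
include h hb hstar hpos

omit [DecidableEq V] h in
lemma span_CP : Submodule.span 𝕜 (Set.range fun γ : {γ // γ ≠ star} => c γ) = CP 𝕜 A J T :=
  span_ne_star hstar (fun γ hγ => Wd_le_ker (hpos γ hγ) (hb.homog γ)) hb.span

/-- The degree of a word. -/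
abbrev degL (star : Γ) (deg : Γ → ℕ) : List {γ // γ ≠ star} → ℕ :=
  listDeg fun γ : {γ // γ ≠ star} => deg γ + 1

omit [DecidableEq V] h hstar hpos in
lemma finFib_degL : FinFib (degL star deg) :=
  finFib_list (finFib_succ (hb.fin.subtype _)) fun _ => Nat.succ_pos _

omit [DecidableEq V] h hstar hpos in
include hdeg in
lemma gf_degL {u y : ℤ⟦X⟧} (hu : (1 + X) * u = 1) (hy : y = -(X * u)) :
    gf (degL star deg) * (1 + X) * (1 + y * gf deg) = 1 := by
  have h1 := gf_list (finFib_succ (hb.fin.subtype (· ≠ star))) fun _ => Nat.succ_pos _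
  rw [gf_succ (fun γ : {γ // γ ≠ star} => deg γ)] at h1
  rw [gf_erase hb.fin star hdeg, hy]
  linear_combination h1 - gf (degL star deg) * X *
    (1 + gf (fun x : {x // x ≠ star} => deg x)) * hu

lemma homBasis_CC (hb' : HomBasis 𝕜 A J S (CC 𝕜 A J S) deg' c') :
    HomBasis 𝕜 A (insert v J) S (CC 𝕜 A (insert v J) S)
      (fun x => degL star deg x.1 + (x.2.1.toNat + deg' x.2.2)) (h.fam star c c') where
  li := h.linearIndependent_fam star c c' hb.li hb'.li hstar
  span := h.span_fam (span_CP hb hstar hpos) hb'.span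
  homog := h.fam_mem_Wd star hb.homog hb'.homog
  fin := (finFib_degL hb).prod (finFib_bool.prod hb'.fin)

lemma homBasis_BB (hb' : HomBasis 𝕜 A J S (BB 𝕜 A J S) deg' c') :
    HomBasis 𝕜 A (insert v J) S (BB 𝕜 A (insert v J) S)
      (fun x : List {γ // γ ≠ star} × Γ' => degL star deg x.1 + deg' x.2)
      (fun x => h.fam star c c' (x.1, false, x.2)) where
  li := (h.linearIndependent_fam star c c' hb.li hb'.li hstar).comp
    (fun x : List {γ // γ ≠ star} × Γ' => (x.1, false, x.2)) fun x y hxy => by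
      simp only [Prod.mk.injEq, true_and] at hxy
      exact Prod.ext hxy.1 hxy.2
  span := h.span_fam_false (span_CP hb hstar hpos) hb'.span
  homog x := by
    simpa using h.fam_mem_Wd star hb.homog hb'.homog (x.1, false, x.2)
  fin := (finFib_degL hb).prod hb'.fin

end Setup

variable (hK : ∀ I ∈ K, ∀ I' ⊆ I, I' ∈ K) (hK0 : ∅ ∈ K)
  (hflag : ∀ S : Finset V, (∀ i ∈ S, ∀ j ∈ S, i ≠ j → {i, j} ∈ K) → S ∈ K)
  {u y : ℤ⟦X⟧} (hu : (1 + X) * u = 1) (hy : y = -(X * u))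
include hK hflag hu hy

/-- The Hilbert series of the spaces `CC`. -/
theorem exists_homBasis_CC (J : Finset V) : ∀ S ⊆ J,
    ∃ (Γ : Type) (star : Γ) (deg : Γ → ℕ) (c : Γ → W 𝕜 (adj K) J S),
      HomBasis 𝕜 (adj K) J S (CC 𝕜 (adj K) J S) deg c ∧ c star = one 𝕜 (adj K) J S ∧
      deg star = 0 ∧ (∀ γ, γ ≠ star → 0 < deg γ) ∧
      gf deg * facePoly K y J = facePoly K y S := by
  induction J using Finset.strongInduction with
  | H J ih =>
  intro S hS
  by_cases hJS : J ⊆ S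
  · obtain rfl := hS.antisymm hJS
    refine ⟨PUnit, ⟨⟩, fun _ => 0, fun _ => one 𝕜 (adj K) S S, ⟨?_, ?_, ?_, ?_⟩, rfl, rfl,
      fun γ hγ => absurd rfl hγ, ?_⟩
    · exact LinearIndependent.of_subsingleton ⟨⟩ one_ne_zero'
    · rw [CC_self, Set.range_const]
    · exact fun _ => one_mem_Wd
    · exact finFib_unique _
    · rw [gf_unique_zero _ rfl, one_mul]
  · obtain ⟨v, hv, hvS⟩ := Finset.not_subset.mp hJS
    obtain ⟨J, hvJ, rfl⟩ : ∃ J', v ∉ J' ∧ insert v J' = J :=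
      ⟨J.erase v, Finset.notMem_erase _ _, Finset.insert_erase hv⟩
    have hSJ : S ⊆ J := fun i hi => Finset.mem_of_mem_insert_of_ne (hS hi) fun e => hvS (e ▸ hi)
    have h := setup_link K hvJ hSJ
    have ih := ih J (Finset.ssubset_insert hvJ)
    obtain ⟨Γ, star, deg, c, hb, hstar, hdeg, hpos, hgf⟩ := ih _ h.subT
    obtain ⟨Γ', star', deg', c', hb', hstar', hdeg', hpos', hgf'⟩ := ih _ hSJ
    refine ⟨_, ([], false, star'), _, _, h.homBasis_CC hb hstar hpos hb', ?_, ?_, ?_, ?_⟩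
    · simp [Setup.fam, hstar']
    · simp [Setup.degL, listDeg, hdeg']
    · rintro ⟨l, ε, γ'⟩ hne
      by_contra h0
      rcases l with _ | ⟨γ, l⟩
      · rcases ε with _ | _
        · refine h0 ?_
          have := hpos' γ' (fun e => hne (by rw [e]))
          simp only
          omega
        · simp at h0
      · simp [Setup.degL, listDeg] at h0
    · have h1 := Setup.gf_degL hb hdeg hu hy
      rw [gf_prod (Setup.finFib_degL hb) (finFib_bool.prod hb'.fin),
        gf_prod finFib_bool hb'.fin, gf_bool, facePoly_insert K hK hflag y hvJ]
      linear_combination gf deg' * facePoly K y J * h1 + hgf' -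
        gf (Setup.degL star deg) * (1 + X) * gf deg' * y * hgf

include hK0 in
/-- The Hilbert series of the orbit of the cyclic vector. -/
theorem exists_homBasis_BB (J : Finset V) :
    ∃ (Γ : Type) (deg : Γ → ℕ) (c : Γ → W 𝕜 (adj K) J ∅),
      HomBasis 𝕜 (adj K) J ∅ (BB 𝕜 (adj K) J ∅) deg c ∧
      gf deg * (1 + X) ^ J.card * facePoly K y J = 1 := by
  induction J using Finset.induction_on with
  | empty =>
    refine ⟨PUnit, fun _ => 0, fun _ => one 𝕜 (adj K) ∅ ∅, ⟨?_, ?_, ?_, ?_⟩, ?_⟩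
    · exact LinearIndependent.of_subsingleton ⟨⟩ one_ne_zero'
    · rw [Set.range_const]
      exact le_antisymm ((Submodule.span_singleton_le_iff_mem _ _).mpr one_mem_BB)
        (BB_le_CC.trans CC_self.le)
    · exact fun _ => one_mem_Wd
    · exact finFib_unique _
    · have : {I ∈ K | I ⊆ ∅} = {∅} := by
        ext I
        simp only [Finset.mem_filter, Finset.subset_empty, Finset.mem_singleton]
        exact ⟨fun h => h.2, fun h => ⟨h ▸ hK0, h⟩⟩
      rw [gf_unique_zero _ rfl, facePoly, this]
      simp
  | insert v J hvJ ih =>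
    have h := setup_link K hvJ (Finset.empty_subset J)
    obtain ⟨Γ', deg', c', hb', hgf'⟩ := ih
    obtain ⟨Γ, star, deg, c, hb, hstar, hdeg, hpos, hgf⟩ :=
      exists_homBasis_CC (𝕜 := 𝕜) K hK hflag hu hy J _ h.subT
    refine ⟨_, _, _, h.homBasis_BB hb hstar hpos hb', ?_⟩
    have h1 := Setup.gf_degL hb hdeg hu hy
    rw [gf_prod (Setup.finFib_degL hb) hb'.fin, facePoly_insert K hK hflag y hvJ,
      Finset.card_insert_of_notMem hvJ, pow_succ]
    linear_combination gf deg' * (1 + X) ^ J.card * facePoly K y J * h1 + hgf' -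
      gf (Setup.degL star deg) * (1 + X) * gf deg' * (1 + X) ^ J.card * y * hgf

end counting

end PolyRep

section nest
variable {k L V : Type*} [CommRing k] [LieRing L] [LieAlgebra k L]

/-- The nested commutator with the letters of a list. -/
def lieNest (q : V → L) (l : List V) (x : L) : L := l.foldr (fun t acc => ⁅q t, acc⁆) x

@[simp] lemma lieNest_nil (q : V → L) (x : L) : lieNest q [] x = x := rfl
@[simp] lemma lieNest_cons (q : V → L) (i : V) (l : List V) (x : L) :
    lieNest q (i :: l) x = ⁅q i, lieNest q l x⁆ := rfl

lemma lieNest_append (q : V → L) (l l' : List V) (x : L) :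
    lieNest q (l ++ l') x = lieNest q l (lieNest q l' x) := List.foldr_append

lemma lieNest_add (q : V → L) (l : List V) (x y : L) :
    lieNest q l (x + y) = lieNest q l x + lieNest q l y := by
  induction l with
  | nil => rfl
  | cons i l ih => simp [ih]

lemma lieNest_zero (q : V → L) (l : List V) : lieNest q l 0 = 0 := by
  induction l with
  | nil => rfl
  | cons i l ih => simp [ih]

lemma lieNest_neg (q : V → L) (l : List V) (x : L) :
    lieNest q l (-x) = -lieNest q l x := by
  rw [eq_neg_iff_add_eq_zero, ← lieNest_add, neg_add_cancel, lieNest_zero]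

variable (N : LieSubalgebra k L) (q : V → L) (n : ℕ)
  (ih : ∀ l b, l ≠ [] → (l ++ [b]).Nodup → l.length < n → lieNest q l (q b) ∈ N)
include ih

lemma lieNest_lie_mem (u p : List V) (b : V) (r : List V) (c : V) (hp : p ≠ []) (hr : r ≠ [])
    (hnd : (u ++ ((p ++ [b]) ++ (r ++ [c]))).Nodup)
    (hn : u.length + p.length + r.length + 1 ≤ n) :
    lieNest q u ⁅lieNest q p (q b), lieNest q r (q c)⁆ ∈ N := by
  induction u using List.reverseRecOn generalizing p r with
  | nil =>
    have h1 := List.length_pos_of_ne_nil hp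
    have h2 := List.length_pos_of_ne_nil hr
    simp only [List.length_nil] at hn
    rw [List.nil_append] at hnd
    exact N.lie_mem (ih p b hp hnd.of_append_left (by omega))
      (ih r c hr hnd.of_append_right (by omega))
  | append_singleton u i ihu =>
    rw [lieNest_append, lieNest_cons, lieNest_nil, leibniz_lie, lieNest_add]
    have e : ((u ++ [i]) ++ ((p ++ [b]) ++ (r ++ [c]))).Perm
      (u ++ ((p ++ [b]) ++ ((i :: r) ++ [c]))) := by
      rw [List.append_assoc]
      exact (List.perm_middle (l₁ := p ++ [b]) (l₂ := r ++ [c]) (a := i)).symm.append_left u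
    refine add_mem (ihu (i :: p) r (by simp) hr ?_ ?_) (ihu p (i :: r) hp (by simp) ?_ ?_)
    · simpa using hnd
    · simp at hn ⊢; omega
    · exact e.nodup_iff.mp hnd
    · simp at hn ⊢; omega

lemma lieNest_perm {l l' : List V} (hl : l.Perm l') (u : List V) (b c : V)
    (hnd : (u ++ (l ++ [b, c])).Nodup) (hn : u.length + l.length + 1 ≤ n) :
    lieNest q (u ++ l) ⁅q b, q c⁆ - lieNest q (u ++ l') ⁅q b, q c⁆ ∈ N := by
  induction hl generalizing u with
  | nil => simp
  | cons i hl ihl =>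
    have := ihl (u ++ [i]) (by simpa using hnd) (by simp at hn ⊢; omega)
    simpa using this
  | swap i j l =>
    have h1 := lieNest_lie_mem N q n ih u [j] i (l ++ [b]) c (by simp) (by simp)
      (by simpa using hnd) (by simp at hn ⊢; omega)
    rw [lieNest_append, lieNest_append, sub_eq_add_neg, ← lieNest_neg, ← lieNest_add]
    convert h1 using 2
    simp only [lieNest_cons, lieNest_append, lieNest_nil]
    rw [lie_lie]
    abel
  | trans h1 _ ih1 ih2 =>
    have := add_mem (ih1 u hnd hn) (ih2 u
      (((h1.append_right _).append_left u).nodup_iff.mp hnd) (by rw [← h1.length_eq]; exact hn))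
    simpa using this

end nest

section GPTW
variable {k L : Type*} [CommRing k] [LieRing L] [LieAlgebra k L] {m : ℕ} (K : Finset (Finset (Fin m)))
  (q : Fin m → L) (hq : ∀ i j, {i, j} ∈ K → ⁅q i, q j⁆ = 0) (N : LieSubalgebra k L)
  (hN : ∀ J j, Theta K J j → cNest q (J.erase j) (q j) ∈ N)
include hq hN

lemma lieNest_mem_step (n : ℕ)
    (ih : ∀ l b, l ≠ [] → (l ++ [b]).Nodup → l.length < n → lieNest q l (q b) ∈ N)
    (l : List (Fin m)) (b : Fin m) (hl : l ≠ []) (hnd : (l ++ [b]).Nodup) (hn : l.length = n) :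
    lieNest q l (q b) ∈ N := by
  set J := (l ++ [b]).toFinset with hJ
  let π := N.toSubmodule.mkQ
  let F : Fin m → Fin m → L ⧸ N.toSubmodule := fun b c =>
    π (lieNest q (((J.erase b).erase c).sort (· ≤ ·)) ⁅q b, q c⁆)
  have hcard : J.card = n + 1 := by
    rw [hJ, List.toFinset_card_of_nodup hnd]; simp [hn]
  have hF : ∀ (l : List (Fin m)) b c, (l ++ [b, c]).Nodup → (l ++ [b, c]).toFinset = J →
      π (lieNest q l ⁅q b, q c⁆) = F b c := by
    intro l b c h1 h2
    have h3 : l.Perm (((J.erase b).erase c).sort (· ≤ ·)) := by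
      refine (List.perm_ext_iff_of_nodup h1.of_append_left (Finset.sort_nodup _ _)).mpr fun i => ?_
      have h4 : i ∈ J ↔ i ∈ l ∨ i = b ∨ i = c := by simp only [← h2, List.toFinset_append, Finset.mem_union, List.mem_toFinset, List.mem_cons, List.not_mem_nil, or_false]
      have h5 : i ∈ l → i ≠ b ∧ i ≠ c := fun hi => by
        have := List.disjoint_of_nodup_append h1 hi
        simpa using this
      rw [Finset.mem_sort, Finset.mem_erase, Finset.mem_erase, h4]
      tauto
    have h6 : l.length + 1 = n := by
      have := List.toFinset_card_of_nodup h1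
      rw [h2, hcard] at this
      simp at this
      omega
    have h7 := lieNest_perm N q n ih h3 [] b c h1 (by simp; omega)
    rw [← sub_eq_zero, ← map_sub]
    exact (Submodule.Quotient.mk_eq_zero _).mpr h7
  have hneg : ∀ b c, F b c = -F c b := by
    intro b c
    simp only [F]
    rw [Finset.erase_right_comm, ← lie_skew, lieNest_neg, map_neg]
  have hjac : ∀ a b c, a ∈ J → b ∈ J → c ∈ J → a ≠ b → b ≠ c → a ≠ c →
      F a b + F b c + F c a = 0 := by
    intro a b c ha hb hc hab hbc hac
    let l₀ := (((J.erase a).erase b).erase c).sort (· ≤ ·)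
    have h1 : (l₀ ++ [a, b, c]).Nodup := by
      refine List.Nodup.append (Finset.sort_nodup _ _) (by simp [hab, hac, hbc]) ?_
      intro i hi hi'
      simp [l₀] at hi hi'
      tauto
    have h2 : (l₀ ++ [a, b, c]).toFinset = J := by
      ext i
      simp only [l₀, List.toFinset_append, Finset.sort_toFinset, Finset.mem_union,
        Finset.mem_erase, List.mem_toFinset, List.mem_cons, List.not_mem_nil, or_false]
      constructor
      · rintro (h | rfl | rfl | rfl) <;> tauto
      · tauto
    have key : ∀ x y z, [x, y, z].Perm [a, b, c] →
        π (lieNest q l₀ ⁅q x, ⁅q y, q z⁆⁆) = F y z := by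
      intro x y z hp
      have hp' : ((l₀ ++ [x]) ++ [y, z]).Perm (l₀ ++ [a, b, c]) := by
        simpa using hp.append_left l₀
      rw [← hF (l₀ ++ [x]) y z (hp'.nodup_iff.mpr h1) (by rw [← h2]; exact List.toFinset_eq_of_perm _ _ hp')]
      rw [lieNest_append, lieNest_cons, lieNest_nil]
    rw [← key c a b (by grind), ← key a b c (by grind), ← key b c a (by grind),
      ← map_add, ← map_add, ← lieNest_add, ← lieNest_add,
      show ⁅q c, ⁅q a, q b⁆⁆ + ⁅q a, ⁅q b, q c⁆⁆ + ⁅q b, ⁅q c, q a⁆⁆ = 0 by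
        rw [← lie_jacobi (q a) (q b) (q c)]; abel, lieNest_zero, map_zero]
  have hbJ : b ∈ J := by simp [hJ]
  let M := J.max' ⟨b, hbJ⟩
  have hM : M ∈ J := J.max'_mem _
  let g : Fin m → L ⧸ N.toSubmodule := fun j => if j = M then 0 else F j M
  have hFg : ∀ b c, b ∈ J → c ∈ J → b ≠ c → F b c = g b - g c := by
    intro b c hb hc hbc
    by_cases h1 : b = M
    · have h2 : c ≠ M := fun e => hbc (h1.trans e.symm)
      simp only [g, h1, h2, if_true, if_false, zero_sub]
      exact hneg _ _
    by_cases h2 : c = M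
    · simp [g, h1, h2]
    have h3 := hjac b c M hb hc hM hbc h2 h1
    simp only [g, h1, h2, if_false]
    rw [hneg M b] at h3
    rw [eq_sub_iff_add_eq]
    rwa [← sub_eq_add_neg, sub_eq_zero] at h3
  have hg : ∀ i j, connKJ K J i j → g i = g j := by
    intro i j hij
    induction hij with
    | refl => rfl
    | @tail b c _ hbc ih' =>
      obtain ⟨hb, hc, hne, he⟩ := hbc
      rw [ih', ← sub_eq_zero, ← hFg b c hb hc hne]
      simp only [F]
      rw [hq _ _ he, lieNest_zero, map_zero]
  have hTheta : ∀ j, Theta K J j → g j = 0 := by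
    intro j hj
    have h1 := hN J j hj
    obtain ⟨hjJ, -, h2⟩ := hj
    have hjM : j ≠ M := fun e => h2 (e ▸ Relation.ReflTransGen.refl)
    have hMs : M ∈ (J.erase j).sort (· ≤ ·) := by simp [hM, Ne.symm hjM]
    have hs : ((J.erase j).sort (· ≤ ·)).Nodup := Finset.sort_nodup _ _
    have hs' : ((J.erase j).sort (· ≤ ·)).Pairwise (· ≤ ·) := Finset.pairwise_sort _ _
    have hs'' : ((J.erase j).sort (· ≤ ·)).toFinset = J.erase j := Finset.sort_toFinset _ _
    change lieNest q ((J.erase j).sort (· ≤ ·)) (q j) ∈ N at h1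
    generalize (J.erase j).sort (· ≤ ·) = s at *
    rcases List.eq_nil_or_concat s with rfl | ⟨s, x, rfl⟩
    · simp at hMs
    have hxJ : x ∈ J.erase j := by rw [← hs'']; simp
    have hx : x = M := by
      refine le_antisymm (J.le_max' _ (Finset.mem_of_mem_erase hxJ)) ?_
      rw [List.concat_eq_append] at hs' hMs
      rcases List.mem_append.mp hMs with h | h
      · exact (List.pairwise_append.mp hs').2.2 M h x (by simp)
      · exact (List.mem_singleton.mp h).le
    rw [List.concat_eq_append] at h1 hs hs''
    rw [lieNest_append, lieNest_cons, lieNest_nil] at h1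
    have h3 : π (lieNest q s ⁅q x, q j⁆) = 0 := (Submodule.Quotient.mk_eq_zero _).mpr h1
    have hjs : j ∉ s ++ [x] := by rw [← List.mem_toFinset, hs'']; simp
    rw [hF s x j ?_ ?_, hFg x j (Finset.mem_of_mem_erase hxJ) hjJ (Finset.ne_of_mem_erase hxJ),
      hx] at h3
    · simpa [g] using h3
    · rw [show s ++ [x, j] = (s ++ [x]) ++ [j] by simp]
      exact List.Nodup.append hs (by simp) (by simpa using hjs)
    · rw [show s ++ [x, j] = (s ++ [x]) ++ [j] by simp, List.toFinset_append, hs'']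
      ext i
      simp only [Finset.mem_union, Finset.mem_erase, List.mem_toFinset, List.mem_singleton]
      constructor
      · rintro (h | rfl) <;> tauto
      · tauto
  have hg0 : ∀ j ∈ J, g j = 0 := by
    intro j hj
    by_cases h1 : connKJ K J j M
    · rw [hg _ _ h1]; simp [g]
    classical
    have hne : {i ∈ J | connKJ K J j i}.Nonempty :=
      ⟨j, Finset.mem_filter.mpr ⟨hj, Relation.ReflTransGen.refl⟩⟩
    have h2 := Finset.mem_filter.mp (Finset.min'_mem _ hne)
    rw [hg _ _ h2.2]
    refine hTheta _ ⟨h2.1, fun i hi hci => ?_, fun h => h1 (h2.2.trans h)⟩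
    exact Finset.min'_le _ _ (Finset.mem_filter.mpr ⟨hi, h2.2.trans hci⟩)
  rcases List.eq_nil_or_concat l with rfl | ⟨l, a, rfl⟩
  · exact absurd rfl hl
  rw [List.concat_eq_append] at hnd hJ ⊢
  rw [lieNest_append, lieNest_cons, lieNest_nil]
  have h1 : l ++ [a, b] = (l ++ [a]) ++ [b] := by simp
  have haJ : a ∈ J := by simp [hJ]
  have hab : a ≠ b := by
    rintro rfl
    simp at hnd
    grind
  have h2 := hF l a b (h1 ▸ hnd) (by rw [h1, hJ])
  rw [hFg a b haJ hbJ hab, hg0 a haJ, hg0 b hbJ, sub_zero] at h2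
  exact (Submodule.Quotient.mk_eq_zero _).mp h2

theorem lieNest_mem (l : List (Fin m)) (b : Fin m) (hl : l ≠ []) (hnd : (l ++ [b]).Nodup) :
    lieNest q l (q b) ∈ N := by
  induction hn : l.length using Nat.strong_induction_on generalizing l b with
  | _ n ih =>
    exact lieNest_mem_step K q hq N hN n (fun l b h1 h2 h3 => ih _ h3 l b h1 h2 rfl) l b hl hnd hn

end GPTW

namespace GraphLie
attribute [local instance] LieRing.ofAssociativeRing
open PolyRep

variable {m : ℕ} (K : Finset (Finset (Fin m)))

section universal
variable {P : Type*} [LieRing P] [LieAlgebra (ZMod 2) P]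

lemma lie_mu (i j : Fin m) (h : ({i, j} : Finset (Fin m)) ∈ K) : ⁅mu K i, mu K j⁆ = 0 := by
  rw [mu, mu, ← LieSubmodule.Quotient.mk_bracket]
  exact LieSubmodule.Quotient.mk_eq_zero'.mpr (LieSubmodule.subset_lieSpan ⟨i, j, h, rfl⟩)

lemma LKrels_le_ker (f : Fin m → P)
    (hf : ∀ i j, ({i, j} : Finset (Fin m)) ∈ K → ⁅f i, f j⁆ = 0) :
    LKrels K ≤ (FreeLieAlgebra.lift (ZMod 2) f).ker := by
  refine LieSubmodule.lieSpan_le.mpr ?_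
  rintro _ ⟨i, j, h, rfl⟩
  simp [LieHom.mem_ker, hf i j h]

variable {K} in
/-- The universal property of `L_K`. -/
noncomputable def lift (f : Fin m → P)
    (hf : ∀ i j, ({i, j} : Finset (Fin m)) ∈ K → ⁅f i, f j⁆ = 0) : LK K →ₗ⁅ZMod 2⁆ P :=
  { (LKrels K).toSubmodule.liftQ (FreeLieAlgebra.lift (ZMod 2) f).toLinearMap
      (fun _ hx => (LKrels_le_ker K f hf hx : _)) with
    map_lie' := by
      intro x y
      obtain ⟨x, rfl⟩ := LieSubmodule.Quotient.surjective_mk' _ x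
      obtain ⟨y, rfl⟩ := LieSubmodule.Quotient.surjective_mk' _ y
      exact LieHom.map_lie (FreeLieAlgebra.lift (ZMod 2) f) x y }

variable {K} in
lemma lift_mu (f : Fin m → P) (hf) (i : Fin m) : lift (K := K) f hf (mu K i) = f i :=
  FreeLieAlgebra.lift_of_apply f i

/-- The quotient map as a Lie algebra homomorphism. -/
noncomputable def mkHom : FreeLieAlgebra (ZMod 2) (Fin m) →ₗ⁅ZMod 2⁆ LK K :=
  FreeLieAlgebra.lift (ZMod 2) (mu K)

lemma mkHom_apply (x) : mkHom K x = LieSubmodule.Quotient.mk' (LKrels K) x := by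
  let g : FreeLieAlgebra (ZMod 2) (Fin m) →ₗ⁅ZMod 2⁆ LK K :=
    { (LieSubmodule.Quotient.mk' (LKrels K)).toLinearMap with map_lie' := fun {x y} => rfl }
  have : mkHom K = g := FreeLieAlgebra.hom_ext fun i => FreeLieAlgebra.lift_of_apply (mu K) i
  rw [this]
  rfl

variable {K} in
lemma hom_ext {f g : LK K →ₗ⁅ZMod 2⁆ P} (h : ∀ i, f (mu K i) = g (mu K i)) : f = g := by
  have : f.comp (mkHom K) = g.comp (mkHom K) := FreeLieAlgebra.hom_ext fun i => by
    simpa [mkHom] using h i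
  ext x
  obtain ⟨x, rfl⟩ := LieSubmodule.Quotient.surjective_mk' _ x
  rw [← mkHom_apply]
  exact LieHom.congr_fun this x

variable {K} in
lemma eq_top_of_mu_mem (T : LieSubalgebra (ZMod 2) (LK K)) (h : ∀ i, mu K i ∈ T) : T = ⊤ := by
  let f : LK K →ₗ⁅ZMod 2⁆ T := lift (fun i => ⟨mu K i, h i⟩) fun i j hij =>
    Subtype.ext (lie_mu K i j hij)
  have hf : T.incl.comp f = LieHom.id := hom_ext fun i => by
    simp [f, lift_mu]
  refine eq_top_iff.mpr fun x _ => ?_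
  have : T.incl (f x) = x := LieHom.congr_fun hf x
  rw [← this]
  exact (f x).2

end universal

/-- The cyclic module underlying the enveloping algebra of `L_K`. -/
abbrev WK := W (ZMod 2) (adj K) Finset.univ ∅

/-- The action of `L_K`. -/
noncomputable def rho : LK K →ₗ⁅ZMod 2⁆ Module.End (ZMod 2) (WK K) :=
  lift (op (ZMod 2) (adj K) Finset.univ ∅) fun i j h => by
    rw [LieRing.of_associative_ring_bracket, isRep_op.comm i j h, sub_self]

lemma rho_mu (i : Fin m) : rho K (mu K i) = op (ZMod 2) (adj K) Finset.univ ∅ i := lift_mu _ _ i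

lemma rho_lie (x y : LK K) (w : WK K) :
    rho K ⁅x, y⁆ w = rho K x (rho K y w) - rho K y (rho K x w) := by
  rw [LieHom.map_lie, LieRing.of_associative_ring_bracket]; rfl

lemma rho_lieNest (l : List (Fin m)) (b : Fin m) :
    rho K (lieNest (mu K) l (mu K b)) = brk (op (ZMod 2) (adj K) Finset.univ ∅) l b := by
  induction l with
  | nil => exact rho_mu K b
  | cons i l ih =>
    rw [lieNest_cons, LieHom.map_lie, LieRing.of_associative_ring_bracket, ih, rho_mu, brk_cons]

/-- The enveloping algebra of `L_K`. -/
abbrev UK := UniversalEnvelopingAlgebra (ZMod 2) (LK K)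

/-- The action of the enveloping algebra. -/
noncomputable def Phi : UK K →ₐ[ZMod 2] Module.End (ZMod 2) (WK K) :=
  UniversalEnvelopingAlgebra.lift (ZMod 2) (rho K)

lemma Phi_ι (x : LK K) : Phi K (UniversalEnvelopingAlgebra.ι (ZMod 2) x) = rho K x :=
  UniversalEnvelopingAlgebra.lift_ι_apply _ _ _

/-- The orbit map of the cyclic vector. -/
noncomputable def orb : UK K →ₗ[ZMod 2] WK K :=
  (LinearMap.applyₗ (one (ZMod 2) (adj K) Finset.univ ∅)).comp (Phi K).toLinearMap

lemma orb_apply (u : UK K) : orb K u = Phi K u (one _ _ _ _) := rfl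

lemma isRep_mul : IsRep (adj K) Finset.univ ∅
    (fun i => LinearMap.mulLeft (ZMod 2) (UniversalEnvelopingAlgebra.ι (ZMod 2) (mu K i)))
    (1 : UK K) where
  comm i j h := by
    have h1 : UniversalEnvelopingAlgebra.ι (ZMod 2) ⁅mu K i, mu K j⁆ = 0 := by
      rw [lie_mu K i j h, map_zero]
    rw [LieHom.map_lie, LieRing.of_associative_ring_bracket, sub_eq_zero] at h1
    ext1 x
    simp only [Module.End.mul_apply, LinearMap.mulLeft_apply, ← mul_assoc, h1]
  zero i h := absurd (Finset.mem_univ i) h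
  kill s h := absurd h (Finset.notMem_empty s)

/-- The comparison map to the enveloping algebra. -/
noncomputable def kap : WK K →ₗ[ZMod 2] UK K := PolyRep.lift (isRep_mul K)

lemma eq_top_of_ι_mem {R L : Type*} [CommRing R] [LieRing L] [LieAlgebra R L]
    (T : Subalgebra R (UniversalEnvelopingAlgebra R L))
    (h : ∀ x, UniversalEnvelopingAlgebra.ι R x ∈ T) : T = ⊤ := by
  let f : L →ₗ⁅R⁆ T :=
    { toFun := fun x => ⟨UniversalEnvelopingAlgebra.ι R x, h x⟩
      map_add' := fun x y => Subtype.ext (map_add _ x y)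
      map_smul' := fun c x => Subtype.ext (map_smul _ c x)
      map_lie' := fun {x y} => Subtype.ext (LieHom.map_lie _ x y) }
  have hf : T.val.comp (UniversalEnvelopingAlgebra.lift R f) = AlgHom.id R _ :=
    UniversalEnvelopingAlgebra.hom_ext (R := R) <| LieHom.ext fun x => by
      simp [f]
  refine eq_top_iff.mpr fun x _ => ?_
  have : T.val (UniversalEnvelopingAlgebra.lift R f x) = x := AlgHom.congr_fun hf x
  rw [← this]
  exact (UniversalEnvelopingAlgebra.lift R f x).2

lemma kap_Phi (u : UK K) (w : WK K) : kap K (Phi K u w) = u * kap K w := by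
  let T : Subalgebra (ZMod 2) (UK K) :=
    { carrier := {u | ∀ w, kap K (Phi K u w) = u * kap K w}
      mul_mem' := fun {a b} ha hb w => by
        rw [map_mul, Module.End.mul_apply, ha, hb, mul_assoc]
      add_mem' := fun {a b} ha hb w => by
        rw [map_add, LinearMap.add_apply, map_add, ha, hb, add_mul]
      algebraMap_mem' := fun c w => by
        rw [AlgHom.commutes, Module.algebraMap_end_apply, map_smul, Algebra.smul_def] }
  let Q : LieSubalgebra (ZMod 2) (LK K) :=
    { T.toSubmodule.comap (UniversalEnvelopingAlgebra.ι (ZMod 2) (L := LK K)).toLinearMap with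
      lie_mem' := fun {x y} hx hy => by
        change UniversalEnvelopingAlgebra.ι (ZMod 2) ⁅x, y⁆ ∈ T
        rw [LieHom.map_lie, LieRing.of_associative_ring_bracket]
        exact sub_mem (mul_mem hx hy) (mul_mem hy hx) }
  have hQ : Q = ⊤ := eq_top_of_mu_mem Q fun i => by
    change UniversalEnvelopingAlgebra.ι (ZMod 2) (mu K i) ∈ T
    intro w
    rw [Phi_ι, rho_mu, kap, lift_op, LinearMap.mulLeft_apply]
  have hT : T = ⊤ := eq_top_of_ι_mem T fun x => by
    have : x ∈ Q := hQ ▸ LieSubalgebra.mem_top x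
    exact this
  have : u ∈ T := hT ▸ Algebra.mem_top
  exact this w

lemma orb_injective : Function.Injective (orb K) := by
  refine Function.LeftInverse.injective (g := kap K) fun u => ?_
  rw [orb_apply, kap_Phi, kap, lift_one, mul_one]

end GraphLie

namespace PolyRep
variable {𝕜 : Type*} [Field 𝕜] {V : Type*} {A : V → V → Prop} {J S : Finset V}

lemma span_range_fibre {Γ : Type*} (deg : Γ → ℕ) (c : Γ → W 𝕜 A J S)
    (hc : ∀ γ, c γ ∈ Wd 𝕜 A J S (deg γ)) (d : ℕ) :
    Submodule.span 𝕜 (Set.range fun γ : {γ // deg γ = d} => c γ) =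
      (Submodule.span 𝕜 (Set.range c)).map (pr 𝕜 A J S d) := by
  rw [Submodule.map_span]
  refine le_antisymm (Submodule.span_mono ?_) (Submodule.span_le.mpr ?_)
  · rintro _ ⟨γ, rfl⟩
    exact ⟨c γ, ⟨γ, rfl⟩, by rw [pr_of_mem (hc γ), if_pos γ.2]⟩
  · rintro _ ⟨_, ⟨γ, rfl⟩, rfl⟩
    rw [pr_of_mem (hc γ)]
    split_ifs with h
    · exact Submodule.subset_span ⟨⟨γ, h⟩, rfl⟩
    · exact Submodule.zero_mem _

lemma gf_eq_of_span_eq {Γ Γ' : Type*} {deg : Γ → ℕ} {deg' : Γ' → ℕ} {c : Γ → W 𝕜 A J S}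
    {c' : Γ' → W 𝕜 A J S} (hc : ∀ γ, c γ ∈ Wd 𝕜 A J S (deg γ))
    (hc' : ∀ γ, c' γ ∈ Wd 𝕜 A J S (deg' γ)) (hi : LinearIndependent 𝕜 c)
    (hi' : LinearIndependent 𝕜 c')
    (h : Submodule.span 𝕜 (Set.range c) = Submodule.span 𝕜 (Set.range c')) :
    GradedCount.gf deg = GradedCount.gf deg' := by
  ext d
  simp only [GradedCount.gf, PowerSeries.coeff_mk]
  have e : Submodule.span 𝕜 (Set.range fun γ : {γ // deg γ = d} => c γ) =
      Submodule.span 𝕜 (Set.range fun γ : {γ // deg' γ = d} => c' γ) := by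
    rw [span_range_fibre deg c hc, span_range_fibre deg' c' hc', h]
  have b := Module.Basis.span (hi.comp _ (Subtype.val_injective (p := fun γ => deg γ = d)))
  have b' := Module.Basis.span (hi'.comp _ (Subtype.val_injective (p := fun γ => deg' γ = d)))
  rw [Nat.card_congr (b.indexEquiv (b'.map (LinearEquiv.ofEq _ _ e.symm)))]

lemma lift_shiftOp_of_mem {d : ℕ} {w : W 𝕜 A J S} (hw : w ∈ Wd 𝕜 A J S d) :
    lift isRep_shiftOp w = Finsupp.single d w := by
  ext1 e
  rw [Finsupp.single_apply]
  exact pr_of_mem hw e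

/-- A family of homogeneous vectors is independent if it is so in each degree. -/
lemma linearIndependent_of_homogeneous {φ : ℕ → Type*} (c : ∀ k, φ k → W 𝕜 A J S)
    (hc : ∀ k i, c k i ∈ Wd 𝕜 A J S k) (hi : ∀ k, LinearIndependent 𝕜 (c k)) :
    LinearIndependent 𝕜 fun p : Σ k, φ k => c p.1 p.2 := by
  refine LinearIndependent.of_comp (lift isRep_shiftOp) ?_
  have e : (lift isRep_shiftOp ∘ fun p : Σ k, φ k => c p.1 p.2) =
      fun p => Finsupp.single p.1 (c p.1 p.2) :=
    funext fun p => lift_shiftOp_of_mem (hc p.1 p.2)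
  rw [e]
  exact Finsupp.linearIndependent_single (R := 𝕜) c hi

end PolyRep

namespace GraphLie
open PolyRep
attribute [local instance] LieRing.ofAssociativeRing

variable {m : ℕ} (K : Finset (Finset (Fin m)))

lemma one_le_of_isBracketing {k : ℕ} {x : FreeLieAlgebra (ZMod 2) (Fin m)} (h : IsBracketing k x) :
    1 ≤ k := by
  induction h with
  | of i => exact le_rfl
  | lie _ _ h1 h2 => omega

lemma finite_isBracketing (k : ℕ) :
    {x : FreeLieAlgebra (ZMod 2) (Fin m) | IsBracketing k x}.Finite := by
  induction k using Nat.strong_induction_on with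
  | _ k ih =>
  refine ((Set.finite_range (FreeLieAlgebra.of (ZMod 2) : Fin m → _)).union
    (Set.Finite.biUnion (Finset.range k).finite_toSet fun a _ =>
      Set.Finite.biUnion (Finset.range k).finite_toSet fun b _ =>
      (?_ : (Set.image2 (fun x y => ⁅x, y⁆) {x : FreeLieAlgebra (ZMod 2) (Fin m) | IsBracketing a x ∧ a < k}
        {x | IsBracketing b x ∧ b < k}).Finite))).subset ?_
  · refine Set.Finite.image2 _ ?_ ?_
    · by_cases h : a < k
      · exact (ih a h).subset fun x hx => hx.1
      · exact Set.finite_empty.subset fun x hx => h hx.2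
    · by_cases h : b < k
      · exact (ih b h).subset fun x hx => hx.1
      · exact Set.finite_empty.subset fun x hx => h hx.2
  · intro x hx
    cases hx with
    | of i => exact Or.inl ⟨i, rfl⟩
    | @lie a b x y ha hb =>
      have h1 := one_le_of_isBracketing ha
      have h2 := one_le_of_isBracketing hb
      refine Or.inr ?_
      simp only [Set.mem_iUnion]
      exact ⟨a, by simp; omega, b, by simp; omega, x, ⟨ha, by omega⟩, y, ⟨hb, by omega⟩, rfl⟩

instance finiteDimensional_LKdeg (k : ℕ) : FiniteDimensional (ZMod 2) (LKdeg K k) := by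
  have : FiniteDimensional (ZMod 2) (FLdeg m k) :=
    FiniteDimensional.span_of_finite _ (finite_isBracketing k)
  exact Module.Finite.map (FLdeg m k) _

instance finiteDimensional_NKdeg (k : ℕ) : FiniteDimensional (ZMod 2) (NKdeg K k) :=
  Submodule.finiteDimensional_of_le inf_le_right

lemma LKdeg_eq_span (k : ℕ) :
    LKdeg K k = Submodule.span (ZMod 2) (mkHom K '' {x | IsBracketing k x}) := by
  rw [LKdeg, FLdeg, Submodule.map_span]
  congr 1
  refine Set.image_congr fun x _ => (mkHom_apply K x).symm

lemma mu_mem_LKdeg (i : Fin m) : mu K i ∈ LKdeg K 1 := by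
  rw [LKdeg_eq_span]
  exact Submodule.subset_span ⟨_, IsBracketing.of i, FreeLieAlgebra.lift_of_apply (mu K) i⟩

variable {K} in
lemma lie_mem_LKdeg {k l : ℕ} {x y : LK K} (hx : x ∈ LKdeg K k) (hy : y ∈ LKdeg K l) :
    ⁅x, y⁆ ∈ LKdeg K (k + l) := by
  rw [LKdeg_eq_span] at hx hy
  induction hx using Submodule.span_induction with
  | mem x h =>
    obtain ⟨x, hx, rfl⟩ := h
    induction hy using Submodule.span_induction with
    | mem y h =>
      obtain ⟨y, hy, rfl⟩ := h
      rw [LKdeg_eq_span, ← LieHom.map_lie]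
      exact Submodule.subset_span ⟨_, IsBracketing.lie hx hy, rfl⟩
    | zero => simp
    | add y z _ _ hy hz => rw [lie_add]; exact add_mem hy hz
    | smul c y _ hy => rw [lie_smul]; exact Submodule.smul_mem _ _ hy
  | zero => simp
  | add x z _ _ hx hz => rw [add_lie]; exact add_mem hx hz
  | smul c x _ hx => rw [smul_lie]; exact Submodule.smul_mem _ _ hx

lemma lieNest_mem_LKdeg (l : List (Fin m)) (b : Fin m) :
    lieNest (mu K) l (mu K b) ∈ LKdeg K (l.length + 1) := by
  induction l with
  | nil => exact mu_mem_LKdeg K b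
  | cons i l ih =>
    rw [lieNest_cons, List.length_cons, add_comm]
    exact lie_mem_LKdeg (mu_mem_LKdeg K i) ih

variable {K} in
lemma rho_mem_Wd {k : ℕ} {x : LK K} (hx : x ∈ LKdeg K k) {d : ℕ} {w : WK K}
    (hw : w ∈ Wd (ZMod 2) (adj K) Finset.univ ∅ d) :
    rho K x w ∈ Wd (ZMod 2) (adj K) Finset.univ ∅ (k + d) := by
  rw [LKdeg_eq_span] at hx
  induction hx using Submodule.span_induction with
  | mem x h =>
    obtain ⟨x, hx, rfl⟩ := h
    induction hx generalizing d w with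
    | of i =>
      rw [mkHom, FreeLieAlgebra.lift_of_apply, rho_mu, add_comm]
      exact op_mem_Wd i hw
    | @lie k l x y _ _ hx hy =>
      rw [LieHom.map_lie, rho_lie]
      refine sub_mem ?_ ?_
      · have := hx (hy hw)
        rwa [← add_assoc] at this
      · have := hy (hx hw)
        rwa [← add_assoc, add_comm l] at this
  | zero => simp
  | add x z _ _ hx hz => rw [map_add]; exact add_mem hx hz
  | smul c x _ hx => rw [map_smul]; exact Submodule.smul_mem _ _ hx

lemma exists_lieNest_of_theta {J : Finset (Fin m)} {j : Fin m} (h : Theta K J j) :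
    ∃ l, l ≠ [] ∧ (l ++ [j]).Nodup ∧
      cNest (mu K) (J.erase j) (mu K j) = lieNest (mu K) l (mu K j) := by
  refine ⟨(J.erase j).sort (· ≤ ·), fun h0 => ?_, ?_, rfl⟩
  · obtain ⟨hj, -, h2⟩ := h
    have h1 : J.max' ⟨j, hj⟩ ∈ (J.erase j).sort (· ≤ ·) := by
      rw [Finset.mem_sort, Finset.mem_erase]
      refine ⟨fun e => h2 ?_, Finset.max'_mem _ _⟩
      rw [e]
      exact Relation.ReflTransGen.refl
    simp [h0] at h1
  · refine List.Nodup.append (Finset.sort_nodup _ _) (by simp) ?_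
    intro i hi hi'
    simp at hi hi'
    exact hi.1 hi'

lemma lieNest_mem_NK (l : List (Fin m)) (b : Fin m) (hl : l ≠ []) (hnd : (l ++ [b]).Nodup) :
    lieNest (mu K) l (mu K b) ∈ NK K :=
  lieNest_mem K (mu K) (lie_mu K) (NK K)
    (fun J j h => LieSubalgebra.subset_lieSpan ⟨J, j, h, rfl⟩) l b hl hnd

/-- An induction principle for the Lie subalgebra `N_K`. -/
lemma NK_le (T : LieSubalgebra (ZMod 2) (LK K))
    (h : ∀ l b, l ≠ [] → (l ++ [b]).Nodup → lieNest (mu K) l (mu K b) ∈ T) : NK K ≤ T := by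
  refine LieSubalgebra.lieSpan_le.mpr ?_
  rintro _ ⟨J, j, hj, rfl⟩
  obtain ⟨l, hl, hnd, e⟩ := exists_lieNest_of_theta K hj
  rw [e]
  exact h l j hl hnd

lemma NK_toSubmodule : (NK K).toSubmodule =
    Submodule.span (ZMod 2) {x | ∃ k, 2 ≤ k ∧ x ∈ NKdeg K k} := by
  refine le_antisymm ?_ (Submodule.span_le.mpr ?_)
  · let T : LieSubalgebra (ZMod 2) (LK K) :=
      { Submodule.span (ZMod 2) {x | ∃ k, 2 ≤ k ∧ x ∈ NKdeg K k} with
        lie_mem' := fun {x y} hx hy => by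
          change x ∈ Submodule.span (ZMod 2) {x | ∃ k, 2 ≤ k ∧ x ∈ NKdeg K k} at hx
          change y ∈ Submodule.span (ZMod 2) {x | ∃ k, 2 ≤ k ∧ x ∈ NKdeg K k} at hy
          change ⁅x, y⁆ ∈ Submodule.span (ZMod 2) {x | ∃ k, 2 ≤ k ∧ x ∈ NKdeg K k}
          induction hx using Submodule.span_induction with
          | mem x h =>
            obtain ⟨k, hk, hx⟩ := h
            induction hy using Submodule.span_induction with
            | mem y h =>
              obtain ⟨l, hl, hy⟩ := h
              exact Submodule.subset_span ⟨k + l, by omega,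
                (NK K).lie_mem hx.1 hy.1, lie_mem_LKdeg hx.2 hy.2⟩
            | zero => simp
            | add y z _ _ hy hz => rw [lie_add]; exact add_mem hy hz
            | smul c y _ hy => rw [lie_smul]; exact Submodule.smul_mem _ _ hy
          | zero => simp
          | add x z _ _ hx hz => rw [add_lie]; exact add_mem hx hz
          | smul c x _ hx => rw [smul_lie]; exact Submodule.smul_mem _ _ hx }
    have : NK K ≤ T := NK_le K T fun l b hl hnd =>
      Submodule.subset_span ⟨l.length + 1, by have := List.length_pos_of_ne_nil hl; omega,
        lieNest_mem_NK K l b hl hnd, lieNest_mem_LKdeg K l b⟩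
    exact this
  · rintro x ⟨k, -, hx⟩
    exact hx.1

end GraphLie

namespace PBW
open Module
attribute [local instance] LieRing.ofAssociativeRing

variable {𝕜 L ι : Type*} [Field 𝕜] [LieRing L] [LieAlgebra 𝕜 L]

/-- Ordered monomials in independent elements of `L` are independent in the enveloping algebra. -/
lemma linearIndependent_sorted [LinearOrder ι] {B : ι → L} (hB : LinearIndependent 𝕜 B) :
    LinearIndependent 𝕜 fun s : Multiset ι =>
      (s.sort.map fun i => UniversalEnvelopingAlgebra.ι 𝕜 (B i)).prod := by
  let _ : LinearOrder (Basis.sumExtendIndex hB) := IsWellOrder.linearOrder WellOrderingRel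
  let b : Basis (Lex (ι ⊕ Basis.sumExtendIndex hB)) 𝕜 L := (Basis.sumExtend hB).reindex toLex
  let f : ι → Lex (ι ⊕ Basis.sumExtendIndex hB) := fun i => toLex (Sum.inl i)
  have hf : ∀ i, b (f i) = B i := fun i => by
    simp only [b, f, Basis.reindex_apply, Equiv.symm_apply_apply]
    exact PolyRep.sumExtend_inl hB i
  have h := (linearIndependent_mono b).comp (fun s : Multiset ι => s.map f)
    (Multiset.map_injective (toLex.injective.comp Sum.inl_injective))
  have e : (fun s : Multiset ι => (s.sort.map fun i => UniversalEnvelopingAlgebra.ι 𝕜 (B i)).prod) =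
      (fun s => mono b s.sort) ∘ fun s : Multiset ι => s.map f := by
    funext s
    rw [Function.comp_apply, ← Multiset.map_sort (r := (· ≤ ·)) (r' := (· ≤ ·)) (f := f) (s := s)
      fun a _ c _ => Sum.Lex.inl_le_inl_iff.symm, mono, List.map_map]
    simp only [Function.comp_def, hf]
  rw [e]
  exact h

lemma ι_injective_of_field : Function.Injective (UniversalEnvelopingAlgebra.ι 𝕜 (L := L)) := by
  let b := Basis.ofVectorSpace 𝕜 L
  let _ : LinearOrder (Basis.ofVectorSpaceIndex 𝕜 L) := IsWellOrder.linearOrder WellOrderingRel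
  exact ι_injective b

lemma comp_ι_injective {V : Type*} [AddCommGroup V] [Module 𝕜 V]
    {f : UniversalEnvelopingAlgebra 𝕜 L →ₗ[𝕜] V} (hf : Function.Injective f) :
    Function.Injective (f.comp (UniversalEnvelopingAlgebra.ι 𝕜 (L := L)).toLinearMap) := by
  rw [LinearMap.coe_comp]
  exact hf.comp ι_injective_of_field

end PBW

namespace GraphLie
open PolyRep
attribute [local instance] LieRing.ofAssociativeRing

variable {m : ℕ} (K : Finset (Finset (Fin m)))

/-- The action of `L_K` on the cyclic vector. -/
noncomputable def theta : LK K →ₗ[ZMod 2] WK K :=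
  (orb K).comp (UniversalEnvelopingAlgebra.ι (ZMod 2) (L := LK K)).toLinearMap

lemma theta_apply (x : LK K) : theta K x = rho K x (one _ _ _ _) :=
  congrArg (fun f : Module.End (ZMod 2) (WK K) => f (one _ _ _ _)) (Phi_ι K x)

lemma theta_injective : Function.Injective (theta K) :=
  PBW.comp_ι_injective (orb_injective K)

variable {K} in
lemma theta_mem_Wd {k : ℕ} {x : LK K} (hx : x ∈ LKdeg K k) :
    theta K x ∈ Wd (ZMod 2) (adj K) Finset.univ ∅ k := by
  have h := rho_mem_Wd (K := K) (d := 0) hx (w := one _ _ _ _) one_mem_Wd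
  rw [theta_apply]
  rwa [Nat.add_zero] at h

/-- The index set of a homogeneous basis of `N_K`. -/
def Ix := {p : Σ k, Fin (nDim K k) // 2 ≤ p.1}

/-- The degree of a basis element. -/
def Ix.deg {K : Finset (Finset (Fin m))} (p : Ix K) : ℕ := p.1.1

/-- A homogeneous basis of `N_K`. -/
noncomputable def bas (p : Ix K) : LK K :=
  (Module.finBasis (ZMod 2) (NKdeg K p.1.1) p.1.2 : NKdeg K p.1.1)

lemma bas_mem (p : Ix K) : bas K p ∈ NKdeg K p.deg := Subtype.property _

lemma linearIndependent_bas : LinearIndependent (ZMod 2) (bas K) := by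
  refine LinearIndependent.of_comp (theta K) ?_
  have h := linearIndependent_of_homogeneous (φ := fun k => Fin (nDim K k))
    (fun k i => theta K (Module.finBasis (ZMod 2) (NKdeg K k) i : NKdeg K k))
    (fun k i => theta_mem_Wd (Subtype.property (Module.finBasis (ZMod 2) (NKdeg K k) i)).2)
    (fun k => ((Module.finBasis (ZMod 2) (NKdeg K k)).linearIndependent.map'
      (NKdeg K k).subtype (Submodule.ker_subtype _)).map' (theta K)
      (LinearMap.ker_eq_bot.mpr (theta_injective K)))
  exact h.comp (fun p : Ix K => p.1) Subtype.val_injective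

lemma span_bas : Submodule.span (ZMod 2) (Set.range (bas K)) = (NK K).toSubmodule := by
  refine le_antisymm (Submodule.span_le.mpr ?_) ?_
  · rintro _ ⟨p, rfl⟩
    exact (bas_mem K p).1
  · rw [NK_toSubmodule]
    refine Submodule.span_le.mpr ?_
    rintro x ⟨k, hk, hx⟩
    have h : (⟨x, hx⟩ : NKdeg K k) ∈
        Submodule.span (ZMod 2) (Set.range (Module.finBasis (ZMod 2) (NKdeg K k))) := by
      rw [Module.Basis.span_eq]; exact Submodule.mem_top
    have h2 := Submodule.mem_map_of_mem (f := (NKdeg K k).subtype) h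
    rw [Submodule.map_span] at h2
    refine Submodule.span_mono ?_ h2
    rintro _ ⟨_, ⟨i, rfl⟩, rfl⟩
    exact ⟨⟨⟨k, i⟩, hk⟩, rfl⟩

noncomputable instance : LinearOrder (Ix K) := IsWellOrder.linearOrder WellOrderingRel

/-- The ordered monomials in the basis of `N_K`, acting on the cyclic vector. -/
noncomputable def monW (s : Multiset (Ix K)) : WK K :=
  orb K ((s.sort.map fun p => UniversalEnvelopingAlgebra.ι (ZMod 2) (bas K p)).prod)

lemma linearIndependent_monW : LinearIndependent (ZMod 2) (monW K) :=
  (PBW.linearIndependent_sorted (linearIndependent_bas K)).map' (orb K)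
    (LinearMap.ker_eq_bot.mpr (orb_injective K))

lemma orb_ι_mul (x : LK K) (u : UK K) :
    orb K (UniversalEnvelopingAlgebra.ι (ZMod 2) x * u) = rho K x (orb K u) := by
  rw [orb_apply, map_mul, Module.End.mul_apply, Phi_ι]; rfl

lemma orb_one : orb K 1 = one _ _ _ _ := by rw [orb_apply, map_one]; rfl

lemma orb_prod_mem_Wd (l : List (Ix K)) :
    orb K ((l.map fun p => UniversalEnvelopingAlgebra.ι (ZMod 2) (bas K p)).prod) ∈
      Wd (ZMod 2) (adj K) Finset.univ ∅ (l.map Ix.deg).sum := by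
  induction l with
  | nil =>
    rw [List.map_nil, List.map_nil, List.prod_nil, orb_one]
    exact one_mem_Wd
  | cons p l ih =>
    rw [List.map_cons, List.map_cons, List.prod_cons, List.sum_cons, orb_ι_mul]
    exact rho_mem_Wd (bas_mem K p).2 ih

lemma monW_mem_Wd (s : Multiset (Ix K)) :
    monW K s ∈ Wd (ZMod 2) (adj K) Finset.univ ∅ (s.map Ix.deg).sum := by
  have h := orb_prod_mem_Wd K s.sort
  have e : (s.map Ix.deg).sum = (s.sort.map Ix.deg).sum := by
    conv_lhs => rw [← Multiset.sort_eq s (· ≤ ·)]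
    rfl
  rw [e]
  exact h

lemma rho_mem_BB {x : LK K} (hx : x ∈ NK K) {w : WK K}
    (hw : w ∈ BB (ZMod 2) (adj K) Finset.univ ∅) :
    rho K x w ∈ BB (ZMod 2) (adj K) Finset.univ ∅ := by
  let T : LieSubalgebra (ZMod 2) (LK K) :=
    { carrier := {x | ∀ w ∈ BB (ZMod 2) (adj K) Finset.univ ∅,
        rho K x w ∈ BB (ZMod 2) (adj K) Finset.univ ∅}
      add_mem' := fun {x y} hx hy w hw => by
        rw [map_add]; exact add_mem (hx w hw) (hy w hw)
      zero_mem' := fun w _ => by rw [map_zero]; exact Submodule.zero_mem _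
      smul_mem' := fun c x hx w hw => by
        rw [map_smul]; exact Submodule.smul_mem _ _ (hx w hw)
      lie_mem' := fun {x y} hx hy w hw => by
        rw [rho_lie]; exact sub_mem (hx _ (hy w hw)) (hy _ (hx w hw)) }
  have h : NK K ≤ T := NK_le K T fun l b hl hnd w hw => by
    rw [rho_lieNest]
    refine cl_stable ?_ hw
    exact ⟨l, b, hl, ⟨hnd, fun i _ => Finset.mem_univ i⟩, rfl⟩
  exact h hx w hw

lemma span_monW : Submodule.span (ZMod 2) (Set.range (monW K)) =
    BB (ZMod 2) (adj K) Finset.univ ∅ := by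
  refine le_antisymm (Submodule.span_le.mpr ?_) ?_
  · rintro _ ⟨s, rfl⟩
    rw [monW]
    generalize s.sort = l
    induction l with
    | nil =>
      rw [List.map_nil, List.prod_nil, orb_one]
      exact one_mem_BB
    | cons p l ih =>
      rw [List.map_cons, List.prod_cons, orb_ι_mul]
      exact rho_mem_BB K (bas_mem K p).1 ih
  · let e : Ix K → UK K := fun p => UniversalEnvelopingAlgebra.ι (ZMod 2) (bas K p)
    have hspan : ∀ x ∈ NK K, UniversalEnvelopingAlgebra.ι (ZMod 2) x ∈
        Submodule.span (ZMod 2) (Set.range e) := fun x hx => by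
      have h : x ∈ Submodule.span (ZMod 2) (Set.range (bas K)) := by
        rw [span_bas]; exact hx
      have h2 := Submodule.mem_map_of_mem
        (f := (UniversalEnvelopingAlgebra.ι (ZMod 2) (L := LK K)).toLinearMap) h
      rw [Submodule.map_span, ← Set.range_comp] at h2
      exact h2
    have he : ∀ p q, e p * e q - e q * e p ∈ Submodule.span (ZMod 2) (Set.range e) :=
      fun p q => by
        rw [← LieRing.of_associative_ring_bracket, ← LieHom.map_lie]
        exact hspan _ ((NK K).lie_mem (bas_mem K p).1 (bas_mem K q).1)
    have hmap : Submodule.span (ZMod 2) (Set.range (monW K)) =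
        (Submodule.span (ZMod 2) (Set.range fun s : Multiset (Ix K) =>
          (s.sort.map e).prod)).map (orb K) := by
      rw [Submodule.map_span, ← Set.range_comp]; rfl
    rw [hmap]
    refine cl_le ?_ ?_
    · rintro _ rfl
      refine ⟨1, Submodule.subset_span ⟨0, by simp⟩, orb_one K⟩
    · rintro _ ⟨l, b, hl, hml, rfl⟩ _ ⟨u, hu, rfl⟩
      rw [← rho_lieNest, ← orb_ι_mul]
      exact Submodule.mem_map_of_mem (PBW.mul_mem_span_sorted e he
        (hspan _ (lieNest_mem_NK K l b hl hml.1)) hu)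

end GraphLie

namespace GradedCount
open PowerSeries

/-- Multisets over a finite type are counted by multiplicity functions. -/
lemma gf_multiset {α : Type*} [Fintype α] (f : α → ℕ) :
    gf (fun s : Multiset α => (s.map f).sum) = gf (fun n : α → ℕ => ∑ a, n a * f a) := by
  classical
  refine (gf_equiv (Multiset.toFinsupp.toEquiv.trans Finsupp.equivFunOnFinite) fun s => ?_).symm
  rw [Finset.sum_multiset_map_count]
  simp only [Equiv.trans_apply, smul_eq_mul]
  symm
  refine Finset.sum_subset (Finset.subset_univ _) fun a _ ha => ?_
  rw [Multiset.count_eq_zero_of_notMem (fun h => ha (Multiset.mem_toFinset.mpr h)), zero_mul]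

/-- In degrees `≤ N`, only the elements of degree `≤ N` contribute multisets. -/
lemma coeff_gf_multiset {α ι : Type*} {deg : ι → ℕ} {e : α → ι} (he : Function.Injective e)
    {N : ℕ} (h : ∀ i, deg i ≤ N → ∃ a, e a = i) {d : ℕ} (hd : d ≤ N) :
    coeff d (gf fun s : Multiset ι => (s.map deg).sum) =
      coeff d (gf fun s : Multiset α => (s.map (deg ∘ e)).sum) := by
  rw [gf, gf, coeff_mk, coeff_mk, Nat.cast_inj]
  refine (Nat.card_congr (Equiv.ofBijective
    (fun s => ⟨s.1.map e, by rw [Multiset.map_map]; exact s.2⟩) ⟨?_, ?_⟩)).symm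
  · intro s t hst
    exact Subtype.ext (Multiset.map_injective he (congrArg Subtype.val hst))
  · rintro ⟨s, hs⟩
    have hm : ∀ i ∈ s, ∃ a, e a = i := fun i hi =>
      h i ((Multiset.le_sum_of_mem (Multiset.mem_map_of_mem deg hi)).trans (hs.le.trans hd))
    choose g hg using hm
    have ht : (s.pmap g fun _ h => h).map e = s := by
      rw [Multiset.map_pmap]
      simp only [hg]
      rw [Multiset.pmap_eq_map, Multiset.map_id']
    refine ⟨⟨s.pmap g fun _ h => h, ?_⟩, Subtype.ext ht⟩
    rw [← Multiset.map_map, ht]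
    exact hs

/-- Two power series with inverses agreeing up to degree `N` agree up to degree `N`. -/
lemma coeff_eq_of_inverse {P Q F G : PowerSeries ℤ} (hP : F * P = 1) (hQ : G * Q = 1) {N : ℕ}
    (h : ∀ d ≤ N, coeff d F = coeff d G) {d : ℕ} (hd : d ≤ N) : coeff d P = coeff d Q := by
  have h1 : (X : PowerSeries ℤ) ^ (N + 1) ∣ F - G := X_pow_dvd_iff.mpr fun k hk => by
    rw [map_sub, h k (Nat.lt_succ_iff.mp hk), sub_self]
  have h2 : (X : PowerSeries ℤ) ^ (N + 1) ∣ P - Q := by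
    have e : P - Q = -(P * Q) * (F - G) := by linear_combination Q * hP - P * hQ
    exact e ▸ h1.mul_left _
  have h3 := X_pow_dvd_iff.mp h2 d (Nat.lt_succ_of_le hd)
  rwa [map_sub, sub_eq_zero] at h3

end GradedCount

namespace GraphLie
open PolyRep GradedCount

variable {m : ℕ} (K : Finset (Finset (Fin m)))

lemma coeff_prod_eq {Q : PowerSeries ℤ}
    (hQ : gf (fun s : Multiset (Ix K) => (s.map Ix.deg).sum) * Q = 1) {N d : ℕ} (hd : d ≤ N) :
    PowerSeries.coeff d (∏ k ∈ Finset.Icc 2 N, ((1 : PowerSeries ℤ) - PowerSeries.X ^ k) ^ nDim K k)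
      = PowerSeries.coeff d Q := by
  let e : (Σ k : Finset.Icc 2 N, Fin (nDim K k)) → Ix K := fun a =>
    ⟨⟨a.1, a.2⟩, (Finset.mem_Icc.mp a.1.2).1⟩
  have he : Function.Injective e := by
    rintro ⟨⟨k, hk⟩, i⟩ ⟨⟨l, hl⟩, j⟩ h
    have h2 : (⟨k, i⟩ : Σ k, Fin (nDim K k)) = ⟨l, j⟩ := congrArg Subtype.val h
    cases h2
    rfl
  have hr : ∀ i : Ix K, i.deg ≤ N → ∃ a, e a = i := fun i hi =>
    ⟨⟨⟨i.1.1, Finset.mem_Icc.mpr ⟨i.2, hi⟩⟩, i.1.2⟩, rfl⟩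
  have h := (gf_fun (Ix.deg ∘ e) fun a =>
    lt_of_lt_of_le Nat.zero_lt_two (Finset.mem_Icc.mp a.1.2).1).2
  rw [Fintype.prod_sigma] at h
  have hp : ∏ k : Finset.Icc 2 N, ∏ i : Fin (nDim K k),
      ((1 : PowerSeries ℤ) - PowerSeries.X ^ (Ix.deg ∘ e) ⟨k, i⟩) =
        ∏ k ∈ Finset.Icc 2 N, ((1 : PowerSeries ℤ) - PowerSeries.X ^ k) ^ nDim K k := by
    rw [← Finset.prod_coe_sort (Finset.Icc 2 N)
      fun k => ((1 : PowerSeries ℤ) - PowerSeries.X ^ k) ^ nDim K k]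
    refine Finset.prod_congr rfl fun k _ => ?_
    exact (Finset.prod_const ((1 : PowerSeries ℤ) - PowerSeries.X ^ (k : ℕ))).trans
      (by rw [Finset.card_univ, Fintype.card_fin])
  rw [hp, ← gf_multiset] at h
  exact coeff_eq_of_inverse h hQ (fun d hd => (coeff_gf_multiset he hr hd).symm) hd

lemma one_add_X_pow_mul_facePoly {u y : PowerSeries ℤ} (hu : (1 + PowerSeries.X) * u = 1)
    (hy : y = -(PowerSeries.X * u)) :
    (1 + PowerSeries.X) ^ (Finset.univ : Finset (Fin m)).card * facePoly K y Finset.univ =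
      ∑ J ∈ (Finset.univ : Finset (Fin m)).powerset,
        PowerSeries.C (∑ I ∈ K.filter (· ⊆ J), (-1 : ℤ) ^ I.card) * PowerSeries.X ^ J.card := by
  have h1 : ∀ I : Finset (Fin m),
      (1 + PowerSeries.X) ^ (Finset.univ : Finset (Fin m)).card * y ^ I.card =
      ∑ J ∈ (Finset.univ : Finset (Fin m)).powerset with I ⊆ J,
        (-1) ^ I.card * (PowerSeries.X : PowerSeries ℤ) ^ J.card := by
    intro I
    have hc := Finset.card_add_card_compl I
    have e1 : (1 + PowerSeries.X) ^ (Finset.univ : Finset (Fin m)).card * y ^ I.card =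
        (-1) ^ I.card * PowerSeries.X ^ I.card * (1 + PowerSeries.X) ^ Iᶜ.card := by
      rw [Finset.card_univ, ← hc, pow_add, hy]
      have h2 : ((1 + PowerSeries.X) ^ I.card * u ^ I.card : PowerSeries ℤ) = 1 := by
        rw [← mul_pow, hu, one_pow]
      rw [neg_pow, mul_pow]
      linear_combination (-1) ^ I.card * PowerSeries.X ^ I.card * (1 + PowerSeries.X) ^ Iᶜ.card * h2
    have e2 : ((1 + PowerSeries.X) ^ Iᶜ.card : PowerSeries ℤ) =
        ∑ T ∈ Iᶜ.powerset, PowerSeries.X ^ T.card := by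
      rw [add_comm, ← Finset.sum_pow_mul_eq_add_pow]
      simp only [one_pow, mul_one]
    rw [e1, e2, Finset.mul_sum]
    refine Finset.sum_bij' (fun T _ => I ∪ T) (fun J _ => J \ I) ?_ ?_ ?_ ?_ ?_
    · intro T _
      simp
    · intro J _
      rw [Finset.mem_powerset, Finset.subset_compl_iff_disjoint_right]
      exact Finset.sdiff_disjoint
    · intro T hT
      rw [Finset.mem_powerset, Finset.subset_compl_iff_disjoint_right] at hT
      exact Finset.union_sdiff_cancel_left hT.symm
    · intro J hJ
      exact Finset.union_sdiff_of_subset (Finset.mem_filter.mp hJ).2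
    · intro T hT
      rw [Finset.mem_powerset, Finset.subset_compl_iff_disjoint_right] at hT
      rw [Finset.card_union_of_disjoint hT.symm, pow_add]
      ring
  rw [facePoly, Finset.mul_sum]
  rw [Finset.filter_true_of_mem fun I _ => Finset.subset_univ I]
  simp only [h1, Finset.sum_filter]
  rw [Finset.sum_comm]
  refine Finset.sum_congr rfl fun J _ => ?_
  rw [map_sum, Finset.sum_mul]
  refine Finset.sum_congr rfl fun I _ => ?_
  split_ifs
  · rw [map_pow, map_neg, map_one]
  · rw [map_zero, zero_mul]

end GraphLie

/-- Let `K` be a flag simplicial complex on `[m]`.  The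
graded components `(N_K)_k` are finite dimensional, and for every `N ≥ 1`,
`∏_{k=2}^{N} (1 − x^k)^{n_k(K)} ≡ Σ_{J ⊆ [m]} (Σ_{I ∈ K, I ⊆ J} (−1)^{|I|}) x^{|J|}
(mod x^{N+1})` in `ℤ[x]`, i.e. the coefficients agree in degrees `≤ N`. -/
theorem NK_poincare_series {m : ℕ} (K : Finset (Finset (Fin m)))
    (hK : IsSimplicialComplex K) (hflag : IsFlag K) :
    (∀ k : ℕ, FiniteDimensional (ZMod 2) (NKdeg K k)) ∧
      ∀ N : ℕ, 1 ≤ N → ∀ d ≤ N,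
        (∏ k ∈ Finset.Icc 2 N,
            ((1 : Polynomial ℤ) - Polynomial.X ^ k) ^ (nDim K k)).coeff d =
          (∑ J ∈ (Finset.univ : Finset (Fin m)).powerset,
            Polynomial.C (∑ I ∈ K.filter (· ⊆ J), (-1 : ℤ) ^ I.card) *
              Polynomial.X ^ J.card).coeff d := by
  refine ⟨GraphLie.finiteDimensional_NKdeg K, fun N _ d hd => ?_⟩
  have hu : (1 + PowerSeries.X) * PowerSeries.invOfUnit (1 + PowerSeries.X : PowerSeries ℤ) 1 = 1 :=
    PowerSeries.mul_invOfUnit _ _ (by simp)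
  obtain ⟨Γ, deg, c, hc, h⟩ := PolyRep.exists_homBasis_BB (𝕜 := ZMod 2) K hK.1 hK.2.1 hflag hu rfl
    Finset.univ
  have hG := PolyRep.gf_eq_of_span_eq hc.homog (GraphLie.monW_mem_Wd K) hc.li
    (GraphLie.linearIndependent_monW K) (hc.span.trans (GraphLie.span_monW K).symm)
  rw [mul_assoc, GraphLie.one_add_X_pow_mul_facePoly K hu rfl, hG] at h
  have h2 := GraphLie.coeff_prod_eq K h hd
  rw [← Polynomial.coeff_coe, ← Polynomial.coeff_coe]
  convert h2 using 2
  · rw [← Polynomial.coeToPowerSeries.ringHom_apply, map_prod]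
    simp
  · rw [← Polynomial.coeToPowerSeries.ringHom_apply, map_sum]
    simp only [map_mul, map_pow, Polynomial.coeToPowerSeries.ringHom_apply, Polynomial.coe_C,
      Polynomial.coe_X]
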